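/- arXiv:2402.08388 — 4 statements merged into one kernel-verified Lean document; each statement's English description precedes it below -/
import Mathlib

section
/- Let q > 0, K ∈ ℕ, and let c_0,…,c_K and d_0,…,d_K be positive real numbers such that Σ_{l=0}^{k} c_l ≤ q·2^{k} and Σ_{l=0}^{k} d_l ≤ q·2^{k} for every k ∈ {0,1,…,K}. Then Σ_{(k₁,k₂): k₁≥0, k₂≥0, k₁+k₂≤K} c_{k₁}·d_{k₂} ≤ q²·(K+1)·2^{K}. -/
/-- If the partial sums of `c` satisfy `Σ_{l≤k} c_l ≤ q 2^k` for all `k < n`, then summation by parts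
bounds the dyadically weighted sum `Σ_{k≤n} c_k 2^(n-k)`. -/
theorem two_mul_sum_mul_two_pow_sub_le (q : ℝ) (c : ℕ → ℝ) (n : ℕ)
    (hc : ∀ k < n, (∑ l ∈ Finset.range (k+1), c l) ≤ q * 2 ^ k) :
    2 * ∑ k ∈ Finset.range (n+1), c k * 2 ^ (n - k) ≤
      2 * ∑ k ∈ Finset.range (n+1), c k + n * q * 2 ^ n := by
  induction n with
  | zero => simp
  | succ n ih =>
    have hn := hc n n.lt_succ_self
    have ih := ih fun k hk => hc k (hk.trans n.lt_succ_self)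
    have hdouble : ∑ k ∈ Finset.range (n+1), c k * (2:ℝ) ^ (n + 1 - k) =
        2 * ∑ k ∈ Finset.range (n+1), c k * 2 ^ (n - k) := by
      rw [Finset.mul_sum]
      refine Finset.sum_congr rfl fun k hk => ?_
      rw [Nat.succ_sub (Finset.mem_range_succ_iff.mp hk), pow_succ]
      ring
    rw [Finset.sum_range_succ _ (n+1), Finset.sum_range_succ c (n+1), hdouble, Nat.sub_self,
      pow_zero, pow_succ]
    push_cast
    linarith

/-- If `c_0,…,c_K` and `d_0,…,d_K` are positive with partial sums
`Σ_{l≤k} c_l ≤ q 2^k` and `Σ_{l≤k} d_l ≤ q 2^k` for all `k ≤ K`, then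
`Σ_{k₁+k₂≤K} c_{k₁} d_{k₂} ≤ q² (K+1) 2^K`. -/
theorem sum_pairs_le (q : ℝ) (hq : 0 < q) (K : ℕ) (c d : ℕ → ℝ)
    (hc_pos : ∀ k ≤ K, 0 < c k) (hd_pos : ∀ k ≤ K, 0 < d k)
    (hc : ∀ k ≤ K, (∑ l ∈ Finset.range (k+1), c l) ≤ q * 2 ^ k)
    (hd : ∀ k ≤ K, (∑ l ∈ Finset.range (k+1), d l) ≤ q * 2 ^ k) :
    (∑ k₁ ∈ Finset.range (K+1), ∑ k₂ ∈ Finset.range (K+1-k₁), c k₁ * d k₂) ≤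
      q ^ 2 * (K+1) * 2 ^ K := by
  have hinner : (∑ k₁ ∈ Finset.range (K+1), ∑ k₂ ∈ Finset.range (K+1-k₁), c k₁ * d k₂) ≤
      q * ∑ k ∈ Finset.range (K+1), c k * 2 ^ (K - k) := by
    rw [Finset.mul_sum]
    refine Finset.sum_le_sum fun k hk => ?_
    have hk := Finset.mem_range_succ_iff.mp hk
    rw [← Finset.mul_sum, Nat.succ_sub hk]
    calc c k * ∑ l ∈ Finset.range (K - k + 1), d l
        ≤ c k * (q * 2 ^ (K - k)) :=
          mul_le_mul_of_nonneg_left (hd _ (Nat.sub_le K k)) (hc_pos k hk).le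
      _ = q * (c k * 2 ^ (K - k)) := by ring
  have hweighted := two_mul_sum_mul_two_pow_sub_le q c K fun k hk => hc k hk.le
  have hK := hc K le_rfl
  have hnonneg : 0 ≤ K * q * 2 ^ K := by positivity
  calc _ ≤ q * ∑ k ∈ Finset.range (K+1), c k * 2 ^ (K - k) := hinner
    _ ≤ q * (q * (K+1) * 2 ^ K) := mul_le_mul_of_nonneg_left (by linarith) hq.le
    _ = q ^ 2 * (K+1) * 2 ^ K := by ring
end

section
/- Let γ > 0 and W > 0, and let (c_k)_{k≥0} and (d_k)_{k≥0} be positive sequences satisfying Σ_{k≥0} c_k ≤ 1, Σ_{k≥0} d_k ≤ 1, and for every k ≥ 0, Σ_{l>k} c_l ≤ γ²·2^{−2k/W} and Σ_{l>k} d_l ≤ γ²·2^{−2k/W}. Then for every integer K ≥ 0, Σ_{(k₁,k₂): k₁+k₂>K} c_{k₁}·d_{k₂} ≤ 2γ²·2^{−2K/W} + γ⁴·K·2^{−2(K−1)/W}. -/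
/-- The sum of the terms of index greater than `m` is a shifted series. -/
theorem tsum_ite_lt_eq_tsum_add {d : ℕ → ℝ} (hd : Summable d) (m : ℕ) :
    (∑' k, if m < k then d k else 0) = ∑' l, d (m + 1 + l) := by
  have hs : Summable fun k => if m < k then d k else 0 :=
    (hd.indicator (Set.Ioi m)).congr fun k => by simp [Set.indicator_apply]
  rw [← hs.sum_add_tsum_nat_add (m + 1), Finset.sum_eq_zero, zero_add]
  · refine tsum_congr fun l => ?_
    rw [if_pos (by omega), add_comm]
  · intro i hi
    rw [if_neg (by have := Finset.mem_range.1 hi; omega)]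

/-- Splitting the sum over pairs with `K < k₁ + k₂` according to `k₁ = 0`, `1 ≤ k₁ ≤ K`
and `K < k₁`. -/
theorem tsum_tail_pairs_eq {c d : ℕ → ℝ} (hc : Summable c) (hd : Summable d)
    (hc0 : ∀ k, 0 ≤ c k) (hd0 : ∀ k, 0 ≤ d k) (K : ℕ) :
    (∑' p : ℕ × ℕ, if K < p.1 + p.2 then c p.1 * d p.2 else 0) =
      c 0 * (∑' l, d (K + 1 + l)) +
        (∑ k ∈ Finset.range K, c (k + 1) * ∑' l, d (K - (k + 1) + 1 + l)) +
        (∑' l, c (K + 1 + l)) * ∑' k, d k := by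
  have hs : Summable fun p : ℕ × ℕ => if K < p.1 + p.2 then c p.1 * d p.2 else 0 :=
    ((hc.mul_of_nonneg hd hc0 hd0).indicator {p : ℕ × ℕ | K < p.1 + p.2}).congr
      fun p => by simp [Set.indicator_apply]
  have hlow : ∀ k ≤ K, (∑' l, if K < k + l then c k * d l else 0) =
      c k * ∑' l, d (K - k + 1 + l) := by
    intro k hk
    rw [← tsum_ite_lt_eq_tsum_add hd, ← tsum_mul_left]
    refine tsum_congr fun l => ?_
    rw [mul_ite, mul_zero]
    exact if_congr (by omega) rfl rfl
  rw [hs.tsum_prod, ← hs.prod.sum_add_tsum_nat_add (K + 1), Finset.sum_range_succ',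
    hlow 0 K.zero_le, Nat.sub_zero, add_comm (Finset.sum _ _), ← tsum_mul_right]
  congr 1
  · congr 1
    exact Finset.sum_congr rfl fun k hk => hlow _ (Finset.mem_range.1 hk)
  · refine tsum_congr fun k => ?_
    rw [← tsum_mul_left, add_comm k]
    exact tsum_congr fun l => if_pos (by omega)


/-- If `(c_k)` and `(d_k)` are positive summable sequences with total sums at
most 1 and tails `Σ_{l>k} c_l ≤ γ² 2^{-2k/W}`, `Σ_{l>k} d_l ≤ γ² 2^{-2k/W}` for all `k ≥ 0`,
then for every `K ≥ 0`,
`Σ_{k₁+k₂>K} c_{k₁} d_{k₂} ≤ 2γ² 2^{-2K/W} + γ⁴ K 2^{-2(K-1)/W}`. -/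
theorem sum_tail_pairs_le (γ W : ℝ) (hγ : 0 < γ) (hW : 0 < W) (c d : ℕ → ℝ)
    (hc_pos : ∀ k, 0 < c k) (hd_pos : ∀ k, 0 < d k)
    (hc_sum : Summable c) (hd_sum : Summable d)
    (hc1 : (∑' k, c k) ≤ 1) (hd1 : (∑' k, d k) ≤ 1)
    (hc_tail : ∀ k : ℕ, (∑' l, c (k + 1 + l)) ≤ γ ^ 2 * (2:ℝ) ^ (-(2*(k:ℝ))/W))
    (hd_tail : ∀ k : ℕ, (∑' l, d (k + 1 + l)) ≤ γ ^ 2 * (2:ℝ) ^ (-(2*(k:ℝ))/W)) :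
    ∀ K : ℕ,
      (∑' p : ℕ × ℕ, if K < p.1 + p.2 then c p.1 * d p.2 else 0) ≤
        2 * γ ^ 2 * (2:ℝ) ^ (-(2*(K:ℝ))/W) + γ ^ 4 * K * (2:ℝ) ^ (-(2*((K:ℝ)-1))/W) := by
  intro K
  have hc0 k := (hc_pos k).le
  have hd0 k := (hd_pos k).le
  rw [tsum_tail_pairs_eq hc_sum hd_sum hc0 hd0]
  have hfirst : c 0 * (∑' l, d (K + 1 + l)) ≤ γ ^ 2 * (2:ℝ) ^ (-(2*(K:ℝ))/W) :=
    (mul_le_of_le_one_left (tsum_nonneg fun l => hd0 _)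
      ((hc_sum.le_tsum 0 fun k _ => hc0 k).trans hc1)).trans (hd_tail K)
  have hlast : (∑' l, c (K + 1 + l)) * (∑' k, d k) ≤ γ ^ 2 * (2:ℝ) ^ (-(2*(K:ℝ))/W) :=
    (mul_le_of_le_one_right (tsum_nonneg fun l => hc0 _) hd1).trans (hc_tail K)
  have hmiddle : ∑ k ∈ Finset.range K, c (k + 1) * ∑' l, d (K - (k + 1) + 1 + l) ≤
      K • (γ ^ 4 * (2:ℝ) ^ (-(2*((K:ℝ)-1))/W)) := by
    refine (Finset.sum_le_card_nsmul _ _ _ fun k hk => ?_).trans_eq (by rw [Finset.card_range])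
    have hk : k + 1 ≤ K := Finset.mem_range.1 hk
    have hshift : Summable fun l => c (k + 1 + l) :=
      hc_sum.comp_injective (add_right_injective (k + 1))
    have hck : c (k + 1) ≤ γ ^ 2 * (2:ℝ) ^ (-(2*(k:ℝ))/W) :=
      (hshift.le_tsum 0 fun l _ => hc0 _).trans (hc_tail k)
    refine (mul_le_mul hck (hd_tail (K - (k + 1))) (tsum_nonneg fun l => hd0 _)
      (by positivity)).trans_eq ?_
    rw [mul_mul_mul_comm, ← pow_add, ← Real.rpow_add two_pos, Nat.cast_sub hk]
    congr 2
    push_cast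
    ring
  rw [nsmul_eq_mul] at hmiddle
  linarith
end

section
/- Let q ∈ ℕ and k ∈ ℕ₀, and for j ∈ {1,…,q} and l ∈ {1,…,2^k} let φ_{j,l} : [0,1] → ℝ be the function φ_{j,l}(u) := ((u − (l−1)·2^{−k})₊)^{j−1} (with the convention t₊⁰ = 1{t ≥ 0}), and let V_k ⊆ L²([0,1], Lebesgue) be the linear span of {φ_{j,l} : 1 ≤ j ≤ q, 1 ≤ l ≤ 2^k}. Then for every v ∈ [0,1] there exists f ∈ V_k such that ∫₀¹ ( ((u−v)₊)^{q−1} − f(u) )² du ≤ (1/(2q−1))·2^{−(2q−1)k}; equivalently, the dictionary Ψ = {u ↦ ((u−v)₊)^{q−1} : v ∈ [0,1]} admits the nested approximation (V_k)_{k≥0} with parameters (q, γ, W) where γ = 1/√(2q−1) and W = 2/(2q−1). -/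
open Set MeasureTheory

/-- The truncated power `t ↦ t₊ⁿ`, with the convention `t₊⁰ = 1{t ≥ 0}`. -/
noncomputable def truncPow (n : ℕ) (t : ℝ) : ℝ :=
  if n = 0 then (if 0 ≤ t then 1 else 0) else (max t 0) ^ n

theorem truncPow_of_nonneg (n : ℕ) {t : ℝ} (ht : 0 ≤ t) : truncPow n t = t ^ n := by
  unfold truncPow
  split_ifs with hn
  · simp [hn]
  · rw [max_eq_left ht]

theorem truncPow_of_neg (n : ℕ) {t : ℝ} (ht : t < 0) : truncPow n t = 0 := by
  unfold truncPow
  split_ifs with hn h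
  · exact absurd h (not_le.mpr ht)
  · rfl
  · rw [max_eq_right ht.le, zero_pow hn]

/-- Binomial expansion of the polynomial `(u - v)ⁿ`, cut off to the left of `b`, in truncated
powers with knot `b`. -/
theorem sum_truncPow_eq_ite (n : ℕ) (b v u : ℝ) :
    ∑ i ∈ Finset.range (n + 1), ((b - v) ^ (n - i) * (n.choose i : ℝ)) * truncPow i (u - b) =
      if b ≤ u then (u - v) ^ n else 0 := by
  split_ifs with h
  · rw [← sub_add_sub_cancel u b v, add_pow]
    refine Finset.sum_congr rfl fun i _ => ?_
    rw [truncPow_of_nonneg i (sub_nonneg.mpr h)]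
    ring
  · refine Finset.sum_eq_zero fun i _ => ?_
    rw [truncPow_of_neg i (by linarith), mul_zero]

/-- If `f` agrees with `(u - v)₊ⁿ` on `[0, 1]` off `[v, b]`, and its squared error on
`[v, b]` is at most `(u - v)²ⁿ`, then its integrated squared error is at most
`(b - v)²ⁿ⁺¹ / (2n + 1)`. -/
theorem setIntegral_truncPow_sub_sq_le (n : ℕ) {v b : ℝ} (hv : 0 ≤ v) (hvb : v ≤ b) (hb : b ≤ 1)
    {f : ℝ → ℝ}
    (hf : ∀ u ∈ Icc (0 : ℝ) 1, (truncPow n (u - v) - f u) ^ 2 ≤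
      (Icc v b).indicator (fun u => (u - v) ^ (2 * n)) u) :
    ∫ u in Icc (0 : ℝ) 1, (truncPow n (u - v) - f u) ^ 2 ≤
      (b - v) ^ (2 * n + 1) / (2 * n + 1) := by
  have hint : IntegrableOn (fun u : ℝ => (u - v) ^ (2 * n)) (Icc v b) :=
    (by fun_prop : Continuous fun u : ℝ => (u - v) ^ (2 * n)).integrableOn_Icc
  calc ∫ u in Icc (0 : ℝ) 1, (truncPow n (u - v) - f u) ^ 2
      ≤ ∫ u in Icc (0 : ℝ) 1, (Icc v b).indicator (fun u => (u - v) ^ (2 * n)) u :=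
        integral_mono_of_nonneg (Filter.Eventually.of_forall fun u => sq_nonneg _)
          (hint.integrable_indicator measurableSet_Icc).integrableOn
          ((ae_restrict_iff' measurableSet_Icc).mpr (Filter.Eventually.of_forall hf))
    _ = ∫ u in v..b, (u - v) ^ (2 * n) := by
        rw [setIntegral_indicator measurableSet_Icc,
          inter_eq_right.mpr (Icc_subset_Icc hv hb), integral_Icc_eq_integral_Ioc,
          intervalIntegral.integral_of_le hvb]
    _ = (b - v) ^ (2 * n + 1) / (2 * n + 1) := by
        rw [intervalIntegral.integral_comp_sub_right (fun u => u ^ (2 * n)), integral_pow]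
        simp

/-- For every `v ∈ [0,1]` the truncated power function `u ↦ (u−v)₊^{q−1}` can
be approximated in `L²([0,1])` within squared error `(1/(2q−1))·2^{−(2q−1)k}` by an element of
the span `V_k` of the functions `u ↦ (u−(l−1)2^{−k})₊^{j−1}`, `1 ≤ j ≤ q`, `1 ≤ l ≤ 2^k`;
i.e. the truncated power dictionary admits the nested approximation `(V_k)` with parameters
`(q, 1/√(2q−1), 2/(2q−1))`. -/
theorem truncPow_nested_approx (q k : ℕ) (hq : 1 ≤ q) :
    ∀ v ∈ Set.Icc (0:ℝ) 1,
      ∃ f ∈ Submodule.span ℝ {g : ℝ → ℝ | ∃ j ∈ Finset.Icc 1 q, ∃ l ∈ Finset.Icc 1 (2 ^ k : ℕ),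
          g = fun u => truncPow (j-1) (u - ((l:ℝ) - 1) * (2:ℝ) ^ (-(k:ℝ)))},
        (∫ u in Set.Icc (0:ℝ) 1, (truncPow (q-1) (u - v) - f u) ^ 2) ≤
          (1 / (2*(q:ℝ) - 1)) * (2:ℝ) ^ (-((2*(q:ℝ) - 1) * (k:ℝ))) := by
  obtain ⟨n, rfl⟩ : ∃ n, q = n + 1 := ⟨q - 1, by omega⟩
  rintro v ⟨hv0, hv1⟩
  have hN : (0 : ℝ) < 2 ^ k := by positivity
  have hpow : (2 : ℝ) ^ (-(k : ℝ)) = ((2 : ℝ) ^ k)⁻¹ := by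
    rw [Real.rpow_neg (by norm_num), Real.rpow_natCast]
  have hrhs : (2 : ℝ) ^ (-((2 * ((n + 1 : ℕ) : ℝ) - 1) * (k : ℝ))) =
      (((2 : ℝ) ^ k)⁻¹) ^ (2 * n + 1) := by
    rw [← hpow, ← Real.rpow_natCast, ← Real.rpow_mul (by norm_num)]
    congr 1
    push_cast
    ring
  rw [hrhs, hpow, Nat.add_sub_cancel]
  obtain ⟨m, hm⟩ : ∃ m, m = ⌈v * 2 ^ k⌉₊ := ⟨_, rfl⟩
  obtain ⟨b, hb⟩ : ∃ b : ℝ, b = m * ((2 : ℝ) ^ k)⁻¹ := ⟨_, rfl⟩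
  have hmN : m ≤ 2 ^ k := by
    rw [hm, Nat.ceil_le]
    push_cast
    nlinarith
  have hvb : v ≤ b := by
    rw [hb, ← div_eq_mul_inv, le_div_iff₀ hN, hm]
    exact Nat.le_ceil _
  have hbv : b - v ≤ ((2 : ℝ) ^ k)⁻¹ := by
    have h := Nat.ceil_lt_add_one (mul_nonneg hv0 hN.le)
    rw [← hm] at h
    rw [hb, sub_le_iff_le_add, ← div_eq_mul_inv, div_le_iff₀ hN, add_mul, inv_mul_cancel₀ hN.ne']
    linarith
  have hb1 : b ≤ 1 := by
    rw [hb, ← div_eq_mul_inv, div_le_one hN]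
    exact_mod_cast hmN
  have bound : ∀ f : ℝ → ℝ, (∀ u ∈ Icc (0 : ℝ) 1, (truncPow n (u - v) - f u) ^ 2 ≤
      (Icc v b).indicator (fun u => (u - v) ^ (2 * n)) u) →
      ∫ u in Icc (0 : ℝ) 1, (truncPow n (u - v) - f u) ^ 2 ≤
        (1 / (2 * ((n + 1 : ℕ) : ℝ) - 1)) * (((2 : ℝ) ^ k)⁻¹) ^ (2 * n + 1) := by
    intro f hf
    refine (setIntegral_truncPow_sub_sq_le n hv0 hvb hb1 hf).trans ?_
    have hq' : 2 * ((n + 1 : ℕ) : ℝ) - 1 = 2 * n + 1 := by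
      push_cast
      ring
    rw [hq', one_div_mul_eq_div]
    gcongr
  rcases hmN.eq_or_lt with hmN | hmN
  · have hb_one : b = 1 := by
      rw [hb, hmN]
      push_cast
      exact mul_inv_cancel₀ hN.ne'
    refine ⟨0, Submodule.zero_mem _, bound _ fun u hu => ?_⟩
    rcases lt_or_ge u v with huv | huv
    · rw [truncPow_of_neg n (by linarith), indicator_of_notMem fun h => huv.not_ge h.1]
      simp
    · rw [truncPow_of_nonneg n (by linarith),
        indicator_of_mem (mem_Icc.mpr ⟨huv, hu.2.trans_eq hb_one.symm⟩), Pi.zero_apply,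
        sub_zero, ← pow_mul, mul_comm]
  · refine ⟨∑ i ∈ Finset.range (n + 1), ((b - v) ^ (n - i) * (n.choose i : ℝ)) •
      fun u => truncPow i (u - b), Submodule.sum_mem _ fun i hi => Submodule.smul_mem _ _
        (Submodule.subset_span ⟨i + 1, ?_, m + 1, ?_, ?_⟩), bound _ fun u hu => ?_⟩
    · rw [Finset.mem_range] at hi
      exact Finset.mem_Icc.mpr ⟨by omega, by omega⟩
    · exact Finset.mem_Icc.mpr ⟨by omega, by omega⟩
    · simp [hb]
    · simp only [Finset.sum_apply, Pi.smul_apply, smul_eq_mul]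
      rw [sum_truncPow_eq_ite]
      rcases lt_or_ge u v with huv | huv
      · rw [truncPow_of_neg n (by linarith), if_neg (by linarith),
          indicator_of_notMem fun h => huv.not_ge h.1]
        simp
      · rw [truncPow_of_nonneg n (by linarith)]
        split_ifs with hbu
        · rw [sub_self, zero_pow two_ne_zero]
          exact indicator_nonneg (fun x hx => pow_nonneg (sub_nonneg.mpr hx.1) _) u
        · rw [indicator_of_mem (mem_Icc.mpr ⟨huv, (not_le.mp hbu).le⟩), sub_zero, ← pow_mul, mul_comm]
end

section
/- Let q ∈ ℕ and d ∈ ℕ, and for v ∈ [0,1] let ψ_v : [0,1] → ℝ be ψ_v(u) := ((u−v)₊)^{q−1} (with t₊⁰ := 1{t ≥ 0} when q = 1). Let F ⊆ L²([0,1]^d, Lebesgue) be the closure of the set of all finite sums f(u₁,…,u_d) = Σ β_{v₁,…,v_d}·ψ_{v₁}(u₁)⋯ψ_{v_d}(u_d) with Σ |β_{v₁,…,v_d}| ≤ 1, the sums ranging over finite subsets of [0,1]^d of indices (v₁,…,v_d). Then there exist a constant C > 0 and ε₀ ∈ (0,1/2], depending only on q and d, such that for all ε ∈ (0,ε₀],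 H(ε, F) ≤ C·ε^{−1/q}·(log(1/ε))^{d−1}·(log(1/ε))^{1/(2q)}, where H(ε,F) is the ε-entropy of F in the L²([0,1]^d) metric. -/
open Metric Set ENNReal MeasureTheory

/-- The `ε`-covering number `N(ε,T)` of a subset `T` of a (pseudo)metric space:
the minimal number of balls of radius `ε` needed to cover `T` (`⊤` if no finite cover exists). -/
noncomputable def covN {E : Type*} [PseudoMetricSpace E] (ε : ℝ) (T : Set E) : ℝ≥0∞ :=
  sInf {n : ℝ≥0∞ | ∃ s : Finset E, (s.card : ℝ≥0∞) = n ∧ T ⊆ ⋃ x ∈ s, Metric.closedBall x ε}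

section HilbertCover

variable {G : Type*} [NormedAddCommGroup G]

/-- The family `0, φ i, -φ i`. -/
def signedFamily {ι : Type*} (φ : ι → G) : Option (ι × Bool) → G
  | none => 0
  | some (i, true) => φ i
  | some (i, false) => -φ i

lemma norm_signedFamily_le {ι : Type*} {φ : ι → G} {r : ℝ} (hr : 0 ≤ r) (h : ∀ i, ‖φ i‖ ≤ r)
    (o : Option (ι × Bool)) : ‖signedFamily φ o‖ ≤ r := by
  rcases o with _ | ⟨i, _ | _⟩ <;> simp [signedFamily, hr, h]

variable [InnerProductSpace ℝ G]

/-- The absolute convex hull of a finite family of vectors. -/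
def absConvSpan {ι : Type*} [Fintype ι] (φ : ι → G) : Set G :=
  {x | ∃ β : ι → ℝ, ∑ i, |β i| ≤ 1 ∧ ∑ i, β i • φ i = x}

lemma norm_le_of_mem_absConvSpan {ι : Type*} [Fintype ι] {φ : ι → G} {r : ℝ} (hr : 0 ≤ r)
    (h : ∀ i, ‖φ i‖ ≤ r) {x : G} (hx : x ∈ absConvSpan φ) : ‖x‖ ≤ r := by
  obtain ⟨β, hβ, rfl⟩ := hx
  calc ‖∑ i, β i • φ i‖ ≤ ∑ i, ‖β i • φ i‖ := norm_sum_le _ _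
    _ ≤ ∑ i, |β i| * r := Finset.sum_le_sum fun i _ => by
        rw [norm_smul, Real.norm_eq_abs]
        exact mul_le_mul_of_nonneg_left (h i) (abs_nonneg _)
    _ = (∑ i, |β i|) * r := by rw [Finset.sum_mul]
    _ ≤ r := mul_le_of_le_one_left hr hβ

lemma exists_inner_le_signedFamily {ι : Type*} [Fintype ι] {φ : ι → G} {x : G}
    (hx : x ∈ absConvSpan φ) (D : G) :
    ∃ o, inner ℝ D x ≤ inner ℝ D (signedFamily φ o) := by
  obtain ⟨β, hβ, rfl⟩ := hx
  obtain ⟨o, ho⟩ := Finite.exists_max fun o => inner ℝ D (signedFamily φ o)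
  refine ⟨o, ?_⟩
  have h0 : 0 ≤ inner ℝ D (signedFamily φ o) := by simpa [signedFamily] using ho none
  rw [inner_sum]
  calc ∑ i, inner ℝ D (β i • φ i) ≤ ∑ i, |β i| * inner ℝ D (signedFamily φ o) := by
        refine Finset.sum_le_sum fun i _ => ?_
        rw [inner_smul_right]
        have h1 : inner ℝ D (φ i) ≤ _ := ho (some (i, true))
        have h2 : inner ℝ D (-φ i) ≤ _ := ho (some (i, false))
        rw [inner_neg_right] at h2
        calc β i * inner ℝ D (φ i) ≤ |β i| * |inner ℝ D (φ i)| := by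
              rw [← abs_mul]; exact le_abs_self _
          _ ≤ _ := mul_le_mul_of_nonneg_left (abs_le'.2 ⟨h1, h2⟩) (abs_nonneg _)
    _ = (∑ i, |β i|) * inner ℝ D (signedFamily φ o) := by rw [Finset.sum_mul]
    _ ≤ _ := mul_le_of_le_one_left h0 hβ

/-- Maurey's lemma, by a greedy choice of the approximating vectors. -/
lemma exists_norm_sum_sub_signedFamily_le {ι : Type*} [Fintype ι] {φ : ι → G} {r : ℝ}
    (hr : 0 ≤ r) (h : ∀ i, ‖φ i‖ ≤ r) {x : G} (hx : x ∈ absConvSpan φ) (s : ℕ) :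
    ∃ o : Fin s → Option (ι × Bool),
      ‖∑ j, (x - signedFamily φ (o j))‖ ^ 2 ≤ s * (2 * r) ^ 2 := by
  induction s with
  | zero => exact ⟨Fin.elim0, by simp⟩
  | succ s ih =>
    obtain ⟨o, ho⟩ := ih
    obtain ⟨p, hp⟩ := exists_inner_le_signedFamily hx (∑ j, (x - signedFamily φ (o j)))
    refine ⟨Fin.snoc o p, ?_⟩
    rw [Fin.sum_univ_castSucc]
    simp only [Fin.snoc_castSucc, Fin.snoc_last]
    have hn : ‖x - signedFamily φ p‖ ≤ 2 * r := by
      have h1 := norm_sub_le x (signedFamily φ p)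
      have h2 := norm_le_of_mem_absConvSpan hr h hx
      have h3 := norm_signedFamily_le hr h p
      linarith
    have hn' := pow_le_pow_left₀ (norm_nonneg _) hn 2
    rw [norm_add_sq_real, inner_sub_right]
    push_cast
    nlinarith

lemma exists_cover_absConvSpan {ι : Type*} [Fintype ι] {φ : ι → G} {r : ℝ}
    (hr : 0 ≤ r) (h : ∀ i, ‖φ i‖ ≤ r) {s : ℕ} (hs : 1 ≤ s) :
    ∃ t : Finset G, t.card ≤ (2 * Fintype.card ι + 1) ^ s ∧
      ∀ x ∈ absConvSpan φ, ∃ c ∈ t, ‖x - c‖ ≤ 2 * r / √s := by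
  classical
  refine ⟨Finset.univ.image fun o : Fin s → Option (ι × Bool) =>
    (s : ℝ)⁻¹ • ∑ j, signedFamily φ (o j), ?_, fun x hx => ?_⟩
  · refine Finset.card_image_le.trans ?_
    simp [mul_comm]
  · obtain ⟨o, ho⟩ := exists_norm_sum_sub_signedFamily_le hr h hx s
    refine ⟨_, Finset.mem_image_of_mem _ (Finset.mem_univ o), ?_⟩
    have hs0 : (0 : ℝ) < s := by exact_mod_cast hs
    have he : x - (s : ℝ)⁻¹ • ∑ j, signedFamily φ (o j)
        = (s : ℝ)⁻¹ • ∑ j, (x - signedFamily φ (o j)) := by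
      rw [Finset.sum_sub_distrib, smul_sub]
      congr 1
      simp only [Finset.sum_const, Finset.card_univ, Fintype.card_fin]
      rw [← Nat.cast_smul_eq_nsmul ℝ, smul_smul, inv_mul_cancel₀ hs0.ne', one_smul]
    rw [he, norm_smul, norm_inv, Real.norm_of_nonneg hs0.le]
    have hsq : √(s : ℝ) ^ 2 = s := Real.sq_sqrt hs0.le
    have hsp : 0 < √(s : ℝ) := Real.sqrt_pos.2 hs0
    have h1 : ‖∑ j, (x - signedFamily φ (o j))‖ ≤ √s * (2 * r) := by
      refine abs_le_of_sq_le_sq' ?_ (by positivity) |>.2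
      rw [mul_pow, hsq]; exact ho
    calc (s : ℝ)⁻¹ * ‖∑ j, (x - signedFamily φ (o j))‖ ≤ (s : ℝ)⁻¹ * (√s * (2 * r)) := by gcongr
      _ = 2 * r / √s := by
        nth_rewrite 1 [← hsq]
        field_simp

lemma exists_cover_ball_two (V : Type*) [NormedAddCommGroup V] [NormedSpace ℝ V]
    [FiniteDimensional ℝ V] :
    ∃ t : Finset V, t.card ≤ 5 ^ Module.finrank ℝ V ∧ ∀ x : V, ‖x‖ ≤ 2 → ∃ c ∈ t, ‖x - c‖ ≤ 1 := by
  classical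
  let P : Finset V → Prop := fun s =>
    (∀ c ∈ s, ‖c‖ ≤ 2) ∧ ∀ c ∈ s, ∀ d ∈ s, c ≠ d → 1 ≤ ‖c - d‖
  have hP : ∀ s, P s → s.card ≤ 5 ^ Module.finrank ℝ V := fun s hs =>
    Besicovitch.card_le_of_separated s hs.1 hs.2
  let A : Set ℕ := {n | ∃ s, P s ∧ s.card = n}
  have hA : BddAbove A := ⟨5 ^ Module.finrank ℝ V, by rintro _ ⟨s, hs, rfl⟩; exact hP s hs⟩
  obtain ⟨s, hs, hcard⟩ : sSup A ∈ A :=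
    Nat.sSup_mem ⟨0, ∅, ⟨by simp, by simp⟩, rfl⟩ hA
  refine ⟨s, hP s hs, fun x hx => ?_⟩
  by_contra! hc
  have hxs : x ∉ s := fun hxs => by simpa using (hc x hxs).trans_le' zero_le_one
  have hins : P (insert x s) := by
    refine ⟨by simpa [hx] using hs.1, fun c hcm d hdm hne => ?_⟩
    rcases Finset.mem_insert.1 hcm with hcx | hcs <;>
      rcases Finset.mem_insert.1 hdm with hdx | hds
    · exact absurd (hcx.trans hdx.symm) hne
    · rw [hcx]; exact (hc d hds).le
    · rw [hdx, norm_sub_rev]; exact (hc c hcs).le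
    · exact hs.2 c hcs d hds hne
  have := le_csSup hA ⟨_, hins, rfl⟩
  rw [Finset.card_insert_of_notMem hxs] at this
  omega

lemma exists_cover_ball (V : Type*) [NormedAddCommGroup V] [NormedSpace ℝ V]
    [FiniteDimensional ℝ V] {r : ℝ} (hr : 0 ≤ r) (p : ℕ) :
    ∃ t : Finset V, t.card ≤ 5 ^ (Module.finrank ℝ V * p) ∧
      ∀ x : V, ‖x‖ ≤ r → ∃ c ∈ t, ‖x - c‖ ≤ r / 2 ^ p := by
  classical
  rcases hr.eq_or_lt with rfl | hr
  · refine ⟨{0}, ?_, fun x hx => ⟨0, by simp, by simpa using hx⟩⟩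
    simpa using Nat.one_le_pow _ _ (by norm_num)
  obtain ⟨u, huc, hu⟩ := exists_cover_ball_two V
  induction p with
  | zero => exact ⟨{0}, by simp, fun x hx => ⟨0, by simp, by simpa using hx⟩⟩
  | succ p ih =>
    obtain ⟨t, htc, ht⟩ := ih
    refine ⟨(t ×ˢ u).image fun z => z.1 + (r / 2 ^ (p + 1)) • z.2, ?_, fun x hx => ?_⟩
    · refine Finset.card_image_le.trans ?_
      rw [Finset.card_product, mul_add, mul_one, pow_add]
      exact Nat.mul_le_mul htc huc
    · obtain ⟨c, hc, hxc⟩ := ht x hx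
      have hρ : 0 < r / 2 ^ (p + 1) := by positivity
      have hρ2 : r / 2 ^ p = r / 2 ^ (p + 1) * 2 := by rw [pow_succ]; field_simp
      set ρ := r / 2 ^ (p + 1)
      obtain ⟨e, he, hxe⟩ := hu (ρ⁻¹ • (x - c)) (by
        rw [norm_smul, norm_inv, Real.norm_of_nonneg hρ.le, inv_mul_le_iff₀ hρ, ← hρ2]
        exact hxc)
      refine ⟨_, Finset.mem_image_of_mem _ (Finset.mk_mem_product hc he), ?_⟩
      have : x - (c + ρ • e) = ρ • (ρ⁻¹ • (x - c) - e) := by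
        rw [smul_sub, smul_smul, mul_inv_cancel₀ hρ.ne', one_smul]; abel
      simp only [this]
      rw [norm_smul, Real.norm_of_nonneg hρ.le]
      exact mul_le_of_le_one_right hρ.le hxe

/-- A cover of an absolute convex hull is refined by covering balls in a subspace `W` close to the
generating vectors, and applying Maurey's lemma to the components orthogonal to `W`. -/
lemma exists_refined_cover_absConvSpan {ι : Type*} [Fintype ι] {φ : ι → G} (W : Submodule ℝ G)
    [FiniteDimensional ℝ W] {r : ℝ} (hr : 0 ≤ r) (hW : ∀ i, ∃ w ∈ W, ‖φ i - w‖ ≤ r)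
    {s : ℕ} (hs : 1 ≤ s) (p : ℕ) {ε : ℝ} (hε : 0 ≤ ε) (t : Finset G)
    (ht : ∀ x ∈ absConvSpan φ, ∃ c ∈ t, ‖x - c‖ ≤ ε) :
    ∃ t' : Finset G,
      t'.card ≤ t.card * (5 ^ (Module.finrank ℝ W * p) * (2 * Fintype.card ι + 1) ^ s) ∧
      ∀ x ∈ absConvSpan φ, ∃ c ∈ t', ‖x - c‖ ≤ ε / 2 ^ p + 2 * r / √s := by
  classical
  have hφ : ∀ i, ‖φ i - W.starProjection (φ i)‖ ≤ r := fun i => by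
    obtain ⟨w, hw, h⟩ := hW i
    rw [Submodule.starProjection_minimal]
    exact (ciInf_le ⟨0, by rintro _ ⟨_, rfl⟩; exact norm_nonneg _⟩ (⟨w, hw⟩ : W)).trans h
  obtain ⟨t₁, ht₁c, ht₁⟩ := exists_cover_absConvSpan hr hφ hs
  obtain ⟨t₂, ht₂c, ht₂⟩ := exists_cover_ball W hε p
  refine ⟨(t ×ˢ (t₂ ×ˢ t₁)).image fun z => W.starProjection z.1 + (z.2.1 + z.2.2), ?_, ?_⟩
  · refine Finset.card_image_le.trans ?_
    rw [Finset.card_product, Finset.card_product]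
    gcongr
  · intro x hx
    obtain ⟨a, ha, hxa⟩ := ht x hx
    obtain ⟨c, hc, hxc⟩ := ht₁ (x - W.starProjection x) (by
      obtain ⟨β, hβ, rfl⟩ := hx
      exact ⟨β, hβ, by simp [smul_sub, Finset.sum_sub_distrib]⟩)
    obtain ⟨b, hb, hxb⟩ := ht₂ (W.orthogonalProjectionOnto (x - a))
      ((Submodule.norm_starProjection_apply_le W (x - a)).trans hxa)
    refine ⟨_, Finset.mem_image_of_mem _ (Finset.mk_mem_product ha (Finset.mk_mem_product hb hc)),
      ?_⟩
    have hb' : ‖W.starProjection (x - a) - b‖ ≤ ε / 2 ^ p := by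
      rw [Submodule.starProjection_apply]; exact_mod_cast hxb
    calc ‖x - (W.starProjection a + (b + c))‖
        = ‖(W.starProjection (x - a) - b) + (x - W.starProjection x - c)‖ := by
          rw [map_sub]; congr 1; abel
      _ ≤ _ := (norm_add_le _ _).trans (add_le_add hb' hxc)

end HilbertCover

section WidthsToEntropy

variable {G : Type*} [NormedAddCommGroup G] [InnerProductSpace ℝ G]

/-- `W n` has dimension `≲ 2ⁿ (n+1)ᵉ` and approximates the family `φ` in square norm up to
`≲ (n+1)ᵉ 2^{-(2q-1)n}`. -/
def HasWidthBound (q e : ℕ) (C₁ C₂ : ℝ) {ι : Type*} (φ : ι → G) : Prop :=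
  ∀ n : ℕ, ∃ W : Submodule ℝ G, FiniteDimensional ℝ W ∧
    (Module.finrank ℝ W : ℝ) ≤ C₁ * (2 ^ n * (n + 1) ^ e) ∧
    ∀ i, ∃ w ∈ W, ‖φ i - w‖ ^ 2 ≤ C₂ * (n + 1) ^ e * (1 / 2) ^ ((2 * q - 1) * n)

lemma exists_cover_of_hasWidthBound_step {q : ℕ} (hq : 1 ≤ q) (e : ℕ) {C₁ C₂ C₃ : ℝ}
    (hC₂ : 0 ≤ C₂) {ι : Type*} [Fintype ι] {φ : ι → G}
    (hφ : HasWidthBound q e C₁ C₂ φ) {L : ℝ} (hL : 1 ≤ L)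
    (hN : Real.log (2 * Fintype.card ι + 1) ≤ C₃ * L) (n : ℕ) {D : ℝ} (hD : 0 ≤ D)
    (hDC : 2 ^ (q + 2) * √C₂ ≤ D) (t : Finset G)
    (ht : ∀ x ∈ absConvSpan φ, ∃ c ∈ t, ‖x - c‖ ≤ D * √L * (1 / 2) ^ (q * n)) :
    ∃ t' : Finset G,
      (t'.card : ℝ) ≤ t.card *
        Real.exp ((2 * (q + 1) * C₁ + C₃) * (2 ^ n * (n + 1) ^ e) + C₃ * L) ∧
      ∀ x ∈ absConvSpan φ, ∃ c ∈ t', ‖x - c‖ ≤ D * √L * (1 / 2) ^ (q * (n + 1)) := by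
  obtain ⟨W, hWfin, hWdim, hWd⟩ := hφ n
  set M : ℝ := 2 ^ n * (n + 1) ^ e with hM
  have hM1 : 1 ≤ M := one_le_mul_of_one_le_of_one_le (one_le_pow₀ (by norm_num))
    (one_le_pow₀ (by linarith [n.cast_nonneg (α := ℝ)]))
  have hL0 : 0 < L := by linarith
  set s : ℕ := ⌈M / L⌉₊ with hs
  have hs1 : 1 ≤ s := Nat.one_le_ceil_iff.2 (by positivity)
  have hsle : M / L ≤ s := Nat.le_ceil _
  have hslt : (s : ℝ) < M / L + 1 := Nat.ceil_lt_add_one (by positivity)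
  set r : ℝ := √(C₂ * (n + 1) ^ e * (1 / 2) ^ ((2 * q - 1) * n)) with hr
  obtain ⟨t', ht'c, ht'⟩ := exists_refined_cover_absConvSpan W (Real.sqrt_nonneg _)
    (fun i => (hWd i).imp fun w hw => ⟨hw.1, Real.le_sqrt_of_sq_le hw.2⟩) hs1 (q + 1)
    (ε := D * √L * (1 / 2) ^ (q * n)) (by positivity) t ht
  refine ⟨t', ?_, fun x hx => (ht' x hx).imp fun c hc => ⟨hc.1, hc.2.trans ?_⟩⟩
  · have hlog : 0 ≤ Real.log (2 * Fintype.card ι + 1) := Real.log_nonneg (by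
      linarith [(Fintype.card ι).cast_nonneg (α := ℝ)])
    have hC₃ : 0 ≤ C₃ := nonneg_of_mul_nonneg_left (hlog.trans hN) hL0
    have h5 : (5 : ℝ) ≤ Real.exp 2 := by
      have h1 := Real.exp_one_gt_d9
      have h2 : Real.exp 2 = Real.exp 1 * Real.exp 1 := by rw [← Real.exp_add]; norm_num
      rw [h2]; nlinarith
    have hA : (5 : ℝ) ^ (Module.finrank ℝ W * (q + 1)) ≤ Real.exp (2 * (q + 1) * C₁ * M) := by
      calc (5 : ℝ) ^ (Module.finrank ℝ W * (q + 1))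
          ≤ Real.exp 2 ^ (Module.finrank ℝ W * (q + 1)) := by gcongr
        _ = Real.exp (2 * (q + 1) * Module.finrank ℝ W) := by
          rw [← Real.exp_nat_mul]; push_cast; ring_nf
        _ ≤ _ := by
          rw [mul_assoc (2 * ((q : ℝ) + 1))]
          gcongr
    have hB : (2 * (Fintype.card ι : ℝ) + 1) ^ s ≤ Real.exp (C₃ * M + C₃ * L) := by
      have hp : (0 : ℝ) < 2 * Fintype.card ι + 1 := by positivity
      calc (2 * (Fintype.card ι : ℝ) + 1) ^ s
          = Real.exp (s * Real.log (2 * Fintype.card ι + 1)) := by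
            rw [Real.exp_nat_mul, Real.exp_log hp]
        _ ≤ Real.exp ((M / L + 1) * (C₃ * L)) := by
            gcongr
        _ = _ := by congr 1; field_simp
    calc (t'.card : ℝ)
        ≤ t.card * ((5 : ℝ) ^ (Module.finrank ℝ W * (q + 1)) *
            (2 * (Fintype.card ι : ℝ) + 1) ^ s) := by exact_mod_cast ht'c
      _ ≤ t.card * (Real.exp (2 * (q + 1) * C₁ * M) * Real.exp (C₃ * M + C₃ * L)) := by gcongr
      _ = _ := by rw [← Real.exp_add]; congr 2; ring
  · have hs0 : (0 : ℝ) < s := by exact_mod_cast hs1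
    have hkey : r / √s ≤ √C₂ * √L * (1 / 2) ^ (q * n) := by
      rw [hr, ← Real.sqrt_div' _ hs0.le]
      refine Real.sqrt_le_iff.2 ⟨by positivity, ?_⟩
      rw [mul_pow, mul_pow, Real.sq_sqrt hC₂, Real.sq_sqrt hL0.le, div_le_iff₀ hs0]
      have h2 : ((1 / 2 : ℝ) ^ (q * n)) ^ 2 * 2 ^ n = (1 / 2) ^ ((2 * q - 1) * n) := by
        have : (q * n) * 2 = (2 * q - 1) * n + n := by
          obtain ⟨k, rfl⟩ := Nat.exists_eq_add_of_le hq
          rw [show 2 * (1 + k) - 1 = 2 * k + 1 by omega]; ring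
        rw [← pow_mul, this, pow_add, mul_assoc, ← mul_pow]; norm_num
      calc C₂ * (n + 1) ^ e * (1 / 2) ^ ((2 * q - 1) * n)
          = C₂ * L * ((1 / 2 : ℝ) ^ (q * n)) ^ 2 * (M / L) := by
            rw [← h2, hM]; field_simp
        _ ≤ _ := by gcongr
    have hp : (2 : ℝ) * (1 / 2) ^ (q + 1) = (1 / 2) ^ q := by rw [pow_succ]; ring
    have e1 : D * √L * (1 / 2) ^ (q * (n + 1))
        = D * √L * (1 / 2) ^ (q * n) / 2 ^ (q + 1) + D * √L * (1 / 2) ^ (q * n) / 2 ^ (q + 1) := by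
      rw [mul_add, mul_one, pow_add, ← hp, one_div_pow 2 (q + 1)]
      ring
    rw [e1]
    refine add_le_add le_rfl ?_
    change 2 * r / √s ≤ _
    rw [le_div_iff₀ (by positivity), mul_div_assoc]
    calc 2 * (r / √s) * 2 ^ (q + 1) ≤ 2 * (√C₂ * √L * (1 / 2) ^ (q * n)) * 2 ^ (q + 1) := by gcongr
      _ = (2 ^ (q + 2) * √C₂) * √L * (1 / 2) ^ (q * n) := by ring
      _ ≤ _ := by gcongr

lemma exists_cover_of_hasWidthBound {q : ℕ} (hq : 1 ≤ q) (e : ℕ) {C₁ C₂ C₃ : ℝ}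
    (hC₂ : 0 ≤ C₂) (hC₃ : 0 ≤ C₃) (hC₁ : 0 ≤ C₁) {ι : Type*} [Fintype ι] {φ : ι → G}
    (hφ1 : ∀ i, ‖φ i‖ ≤ 1) (hφ : HasWidthBound q e C₁ C₂ φ) {L : ℝ} (hL : 1 ≤ L)
    (hN : Real.log (2 * Fintype.card ι + 1) ≤ C₃ * L) {D : ℝ} (hD : 1 ≤ D)
    (hDC : 2 ^ (q + 2) * √C₂ ≤ D) (n : ℕ) :
    ∃ t : Finset G,
      (t.card : ℝ) ≤
        Real.exp ((2 * (q + 1) * C₁ + C₃) * (2 ^ n * (n + 1) ^ e) + n * (C₃ * L)) ∧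
      ∀ x ∈ absConvSpan φ, ∃ c ∈ t, ‖x - c‖ ≤ D * √L * (1 / 2) ^ (q * n) := by
  induction n with
  | zero =>
    refine ⟨{0}, ?_, fun x hx => ⟨0, by simp, ?_⟩⟩
    · simp only [Finset.card_singleton, Nat.cast_one]
      exact Real.one_le_exp (by positivity)
    · have := norm_le_of_mem_absConvSpan zero_le_one hφ1 hx
      have h1 : 1 ≤ √L := Real.one_le_sqrt.2 hL
      simp only [sub_zero, mul_zero, pow_zero, mul_one]
      nlinarith
  | succ n ih =>
    obtain ⟨t, htc, ht⟩ := ih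
    obtain ⟨t', ht'c, ht'⟩ := exists_cover_of_hasWidthBound_step hq e hC₂ hφ hL hN n
      (by linarith) hDC t ht
    refine ⟨t', ht'c.trans ?_, ht'⟩
    refine (mul_le_mul_of_nonneg_right htc (Real.exp_pos _).le).trans ?_
    rw [← Real.exp_add]
    apply Real.exp_le_exp.2
    have hK : 0 ≤ 2 * (q + 1) * C₁ + C₃ := by positivity
    have h1 : (2 : ℝ) ^ n * (n + 1) ^ e + 2 ^ n * (n + 1) ^ e
        ≤ 2 ^ (n + 1) * (((n + 1 : ℕ) : ℝ) + 1) ^ e := by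
      calc (2 : ℝ) ^ n * (n + 1) ^ e + 2 ^ n * (n + 1) ^ e = 2 ^ (n + 1) * (n + 1) ^ e := by ring
        _ ≤ _ := by gcongr; linarith
    have := mul_le_mul_of_nonneg_left h1 hK
    push_cast
    push_cast at this
    linarith

/-- Entropy bound for the absolute convex hull of a family satisfying a width bound. -/
lemma exists_entropy_bound_of_hasWidthBound {q : ℕ} (hq : 1 ≤ q) (e : ℕ) {C₁ C₂ C₃ : ℝ}
    (hC₂ : 0 ≤ C₂) (hC₃ : 0 ≤ C₃) (hC₁ : 0 ≤ C₁) :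
    ∃ C > (0 : ℝ), ∀ ε ∈ Set.Ioc (0 : ℝ) (Real.exp (-1)),
      ∀ (ι : Type) [Fintype ι] (φ : ι → G), (∀ i, ‖φ i‖ ≤ 1) → HasWidthBound q e C₁ C₂ φ →
      Real.log (2 * Fintype.card ι + 1) ≤ C₃ * Real.log (1 / ε) →
      ∃ t : Finset G,
        (t.card : ℝ) ≤ Real.exp (C * ε ^ (-(1 / (q : ℝ))) * Real.log (1 / ε) ^ e *
          Real.log (1 / ε) ^ (1 / (2 * (q : ℝ)))) ∧
        ∀ x ∈ absConvSpan φ, ∃ c ∈ t, ‖x - c‖ ≤ ε / 2 := by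
  set D : ℝ := 2 ^ (q + 2) * √C₂ + 1 with hD
  have hD1 : 1 ≤ D := by rw [hD]; linarith [show 0 ≤ 2 ^ (q + 2) * √C₂ by positivity]
  set A : ℝ := (Real.log (2 * D) + 2) / Real.log 2 + 2 with hA
  have hl2 : 0 < Real.log 2 := Real.log_pos (by norm_num)
  have hlD : 0 ≤ Real.log (2 * D) := Real.log_nonneg (by linarith)
  have hA2 : 2 ≤ A := by rw [hA]; linarith [show 0 ≤ (Real.log (2 * D) + 2) / Real.log 2 by positivity]
  set K : ℝ := 2 * (q + 1) * C₁ + C₃ with hK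
  have hK0 : 0 ≤ K := by positivity
  refine ⟨K * (4 * D) * A ^ e + A * C₃ * (4 * q ^ 2) + 1, by positivity, ?_⟩
  intro ε hε ι _ φ hφ1 hφ hN
  have hε0 : 0 < ε := hε.1
  set L := Real.log (1 / ε) with hLdef
  have hL : 1 ≤ L := by
    rw [hLdef, Real.le_log_iff_exp_le (by positivity), one_div, le_inv_comm₀ (Real.exp_pos _) hε0,
      ← Real.exp_neg]
    exact hε.2
  have hL0 : 0 < L := by linarith
  have hq0 : (0 : ℝ) < q := by exact_mod_cast hq
  have hq1 : (1 : ℝ) ≤ q := by exact_mod_cast hq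
  have hεe : ε = Real.exp (-L) := by rw [hLdef, one_div, Real.log_inv, neg_neg, Real.exp_log hε0]
  have hε1 : ε ≤ 1 := by rw [hεe]; exact Real.exp_le_one_iff.2 (by linarith)
  have hsL : 1 ≤ √L := Real.one_le_sqrt.2 hL
  set Y : ℝ := 2 * D * √L / ε with hY
  have hY1 : 1 ≤ Y := by
    rw [hY, le_div_iff₀ hε0]; nlinarith
  set X : ℝ := Y ^ (1 / (q : ℝ)) with hX
  have hX1 : 1 ≤ X := Real.one_le_rpow hY1 (by positivity)
  obtain ⟨n, hn1, hn2⟩ := exists_nat_pow_near hX1 (one_lt_two)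
  obtain ⟨t, htc, ht⟩ := exists_cover_of_hasWidthBound hq e hC₂ hC₃ hC₁ hφ1 hφ hL hN hD1
    (by rw [hD]; linarith) (n + 1)
  refine ⟨t, htc.trans (Real.exp_le_exp.2 ?_), fun x hx => (ht x hx).imp fun c hc =>
    ⟨hc.1, hc.2.trans ?_⟩⟩
  · -- the exponent
    have hXle : X ≤ 2 * D * (ε ^ (-(1 / (q : ℝ))) * L ^ (1 / (2 * (q : ℝ)))) := by
      rw [hX, hY, Real.div_rpow (by positivity) hε0.le, Real.mul_rpow (by positivity) (by positivity),
        Real.rpow_neg hε0.le, Real.sqrt_eq_rpow, ← Real.rpow_mul hL0.le]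
      have h1 : (2 * D) ^ (1 / (q : ℝ)) ≤ 2 * D := by
        refine (Real.rpow_le_rpow_of_exponent_le (by linarith)
          ((div_le_one hq0).2 hq1)).trans_eq (Real.rpow_one _)
      have h2 : 1 / 2 * (1 / (q : ℝ)) = 1 / (2 * q) := by field_simp
      rw [h2, div_eq_mul_inv, mul_assoc, mul_comm (L ^ _)]
      gcongr
    have hnA : ((n + 1 : ℕ) : ℝ) + 1 ≤ A * L := by
      have h1 : (n : ℝ) * Real.log 2 ≤ Real.log X := by
        rw [← Real.log_pow]
        exact Real.log_le_log (by positivity) hn1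
      have h2 : Real.log X ≤ Real.log Y := by
        rw [hX, Real.log_rpow (by linarith)]
        exact mul_le_of_le_one_left (Real.log_nonneg hY1) ((div_le_one hq0).2 hq1)
      have h3 : Real.log Y = Real.log (2 * D) + Real.log L / 2 + L := by
        rw [hY, Real.log_div (by positivity) hε0.ne', Real.log_mul (by positivity) (by positivity),
          Real.log_sqrt hL0.le, hLdef, one_div, Real.log_inv ε]
        ring
      have h4 := Real.log_le_sub_one_of_pos hL0
      have h5 : (n : ℝ) ≤ (Real.log (2 * D) + 2) / Real.log 2 * L := by
        rw [div_mul_eq_mul_div, le_div_iff₀ hl2]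
        nlinarith
      push_cast
      rw [hA]; nlinarith
    have hL2 : L ^ 2 ≤ 4 * q ^ 2 * ε ^ (-(1 / (q : ℝ))) := by
      have h1 : L / (2 * q) ≤ Real.exp (L / (2 * q)) := by
        linarith [Real.add_one_le_exp (L / (2 * q))]
      have h2 := pow_le_pow_left₀ (by positivity) h1 2
      have h3 : Real.exp (L / (2 * q)) ^ 2 = ε ^ (-(1 / (q : ℝ))) := by
        rw [hεe, ← Real.exp_mul, ← Real.exp_nat_mul]; congr 1; push_cast; field_simp
      rw [h3, div_pow, div_le_iff₀ (by positivity)] at h2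
      linarith
    have hLe : 1 ≤ L ^ e := one_le_pow₀ hL
    have hLq : 1 ≤ L ^ (1 / (2 * (q : ℝ))) := Real.one_le_rpow hL (by positivity)
    set P : ℝ := ε ^ (-(1 / (q : ℝ))) with hP
    have hP0 : 0 < P := by positivity
    set R : ℝ := L ^ (1 / (2 * (q : ℝ))) with hR
    have hpow : (2 : ℝ) ^ (n + 1) ≤ 4 * D * (P * R) := by rw [pow_succ]; linarith
    have hmain : K * (2 ^ (n + 1) * (((n + 1 : ℕ) : ℝ) + 1) ^ e)
        ≤ K * (4 * D * (P * R) * (A * L) ^ e) := by gcongr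
    have hrest : ((n + 1 : ℕ) : ℝ) * (C₃ * L) ≤ A * C₃ * (4 * q ^ 2) * (P * L ^ e * R) := by
      calc ((n + 1 : ℕ) : ℝ) * (C₃ * L) ≤ (A * L) * (C₃ * L) := by
            gcongr; linarith
        _ = A * C₃ * L ^ 2 := by ring
        _ ≤ A * C₃ * (4 * q ^ 2 * P) := by gcongr
        _ = A * C₃ * (4 * q ^ 2) * (P * 1 * 1) := by ring
        _ ≤ _ := by gcongr
    have hpos : 0 ≤ P * L ^ e * R := by positivity
    rw [mul_pow] at hmain
    calc _ ≤ K * (4 * D * (P * R) * (A ^ e * L ^ e)) + A * C₃ * (4 * q ^ 2) * (P * L ^ e * R) :=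
          add_le_add hmain hrest
      _ = (K * (4 * D) * A ^ e + A * C₃ * (4 * q ^ 2)) * (P * L ^ e * R) := by ring
      _ ≤ (K * (4 * D) * A ^ e + A * C₃ * (4 * q ^ 2) + 1) * (P * L ^ e * R) :=
          mul_le_mul_of_nonneg_right (by linarith) hpos
      _ = _ := by ring
  · -- the radius
    have h1 : Y ≤ 2 ^ (q * (n + 1)) := by
      calc Y = X ^ q := by
            rw [hX, ← Real.rpow_natCast, ← Real.rpow_mul (by linarith), one_div,
              inv_mul_cancel₀ hq0.ne', Real.rpow_one]
        _ ≤ (2 ^ (n + 1)) ^ q := by gcongr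
        _ = _ := by rw [← pow_mul, mul_comm]
    rw [hY, div_le_iff₀ hε0] at h1
    rw [one_div, inv_pow, ← div_eq_mul_inv, div_le_iff₀ (by positivity)]
    linarith

end WidthsToEntropy

section TensorWidths

lemma card_filter_sum_eq_le (e N j : ℕ) :
    ((Fintype.piFinset fun _ : Fin (e + 1) => Finset.range N).filter
      fun κ => ∑ i, κ i = j).card ≤ (j + 1) ^ e := by
  have hc : (Fintype.piFinset fun _ : Fin e => Finset.range (j + 1)).card = (j + 1) ^ e := by
    simp
  rw [← hc]
  refine Finset.card_le_card_of_injOn (fun κ i => κ i.succ) (fun κ hκ => ?_) ?_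
  · have h := (Finset.mem_filter.1 hκ).2
    refine Finset.mem_coe.2 (Fintype.mem_piFinset.2 fun i => Finset.mem_range_succ_iff.2 ?_)
    rw [← h]
    exact Finset.single_le_sum (f := κ) (fun _ _ => Nat.zero_le _) (Finset.mem_univ i.succ)
  · intro κ hκ κ' hκ' h
    have h1 := (Finset.mem_filter.1 (Finset.mem_coe.1 hκ)).2
    have h2 := (Finset.mem_filter.1 (Finset.mem_coe.1 hκ')).2
    have h3 : ∀ i : Fin e, κ i.succ = κ' i.succ := fun i => congrFun h i
    rw [Fin.sum_univ_succ] at h1 h2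
    simp only [h3] at h1
    funext i
    refine Fin.cases ?_ h3 i
    omega

lemma sum_filter_lt_two_pow_le (e n : ℕ) :
    ∑ κ ∈ (Fintype.piFinset fun _ : Fin (e + 1) => Finset.range (n + 1)).filter
      (fun κ => ∑ i, κ i < n), 2 ^ (∑ i, κ i) ≤ 2 ^ n * (n + 1) ^ e := by
  rw [← Finset.sum_fiberwise_of_maps_to (t := Finset.range n)
    (g := fun κ : Fin (e + 1) → ℕ => ∑ i, κ i) (fun κ hκ => ?_)]
  swap
  · exact Finset.mem_range.2 (Finset.mem_filter.1 hκ).2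
  calc _ ≤ ∑ j ∈ Finset.range n, (n + 1) ^ e * 2 ^ j := by
        refine Finset.sum_le_sum fun j hj => ?_
        rw [Finset.sum_congr rfl (g := fun _ => 2 ^ j)
          (fun κ hκ => by rw [(Finset.mem_filter.1 hκ).2]), Finset.sum_const, smul_eq_mul]
        refine Nat.mul_le_mul_right _ ?_
        refine (Finset.card_le_card ?_).trans ((card_filter_sum_eq_le e (n + 1) j).trans
          (Nat.pow_le_pow_left (by have := Finset.mem_range.1 hj; omega) e))
        exact Finset.filter_subset_filter _ (Finset.filter_subset _ _)
    _ = (n + 1) ^ e * ∑ j ∈ Finset.range n, 2 ^ j := by rw [Finset.mul_sum]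
    _ ≤ _ := by
      rw [mul_comm]
      refine Nat.mul_le_mul_right _ ?_
      rw [Nat.geomSum_eq le_rfl]
      simp

lemma sum_filter_ge_pow_le (e n : ℕ) {a : ℝ} (ha : 0 ≤ a) (ha2 : a ≤ 1 / 2) :
    ∑ κ ∈ (Fintype.piFinset fun _ : Fin (e + 1) => Finset.range (n + 1)).filter
      (fun κ => ¬ ∑ i, κ i < n), a ^ (∑ i, κ i) ≤ 2 * (e + 1) ^ e * (n + 1) ^ e * a ^ n := by
  rw [← Finset.sum_fiberwise_of_maps_to (t := Finset.Ico n ((e + 1) * n + 1))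
    (g := fun κ => ∑ i, κ i) (fun κ hκ => ?_)]
  · calc _ ≤ ∑ j ∈ Finset.Ico n ((e + 1) * n + 1), (((e : ℝ) + 1) * (n + 1)) ^ e * a ^ j := by
          refine Finset.sum_le_sum fun j hj => ?_
          rw [Finset.sum_congr rfl (g := fun _ => a ^ j)
            (fun κ hκ => by rw [(Finset.mem_filter.1 hκ).2]), Finset.sum_const, nsmul_eq_mul]
          refine mul_le_mul_of_nonneg_right ?_ (pow_nonneg ha _)
          have h1 := (Finset.card_le_card (Finset.filter_subset_filter (fun κ => ∑ i, κ i = j)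
            (Finset.filter_subset (fun κ => ¬ ∑ i, κ i < n)
              (Fintype.piFinset fun _ : Fin (e + 1) => Finset.range (n + 1))))).trans
            (card_filter_sum_eq_le e (n + 1) j)
          have h2 : j + 1 ≤ (e + 1) * (n + 1) := by
            have := (Finset.mem_Ico.1 hj).2
            nlinarith
          exact_mod_cast h1.trans (Nat.pow_le_pow_left h2 e)
      _ = (((e : ℝ) + 1) * (n + 1)) ^ e * ∑ j ∈ Finset.Ico n ((e + 1) * n + 1), a ^ j := by
          rw [Finset.mul_sum]
      _ ≤ (((e : ℝ) + 1) * (n + 1)) ^ e * (2 * a ^ n) := by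
          gcongr
          refine (geom_sum_Ico_le_of_lt_one ha (by linarith)).trans ?_
          rw [div_le_iff₀ (by linarith)]
          nlinarith [pow_nonneg ha n]
      _ = _ := by rw [mul_pow]; ring
  · have h := Finset.mem_filter.1 hκ
    refine Finset.mem_Ico.2 ⟨not_lt.1 h.2, Nat.lt_succ_of_le ?_⟩
    calc ∑ i, κ i ≤ ∑ _i : Fin (e + 1), n := Finset.sum_le_sum fun i _ =>
          Finset.mem_range_succ_iff.1 (Fintype.mem_piFinset.1 h.1 i)
      _ = _ := by simp

variable {E G : Type*} [NormedAddCommGroup E] [InnerProductSpace ℝ E]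
  [NormedAddCommGroup G] [InnerProductSpace ℝ G]

lemma norm_sum_sq_of_pairwise_inner_eq_zero {ι : Type*} (s : Finset ι) (x : ι → G)
    (h : ∀ i ∈ s, ∀ j ∈ s, i ≠ j → inner ℝ (x i) (x j) = 0) :
    ‖∑ i ∈ s, x i‖ ^ 2 = ∑ i ∈ s, ‖x i‖ ^ 2 := by
  rw [← real_inner_self_eq_norm_sq, sum_inner]
  refine Finset.sum_congr rfl fun i hi => ?_
  rw [inner_sum, Finset.sum_eq_single_of_mem i hi fun j hj hne => h i hi j hj hne.symm,
    real_inner_self_eq_norm_sq]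

/-- The blocks of the decomposition of `f` along the increasing subspaces `V 0, …, V n`: the
increments of the projections, and the remainder as the `n`-th block. -/
noncomputable def projBlock (V : ℕ → Submodule ℝ E) [∀ k, FiniteDimensional ℝ (V k)] (n : ℕ)
    (f : E) (k : ℕ) : E :=
  if k < n then (V (k + 1)).starProjection f - (V k).starProjection f
  else f - (V k).starProjection f

variable {V : ℕ → Submodule ℝ E} [∀ k, FiniteDimensional ℝ (V k)]

lemma sum_projBlock (h0 : V 0 = ⊥) (n : ℕ) (f : E) :
    ∑ k ∈ Finset.range (n + 1), projBlock V n f k = f := by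
  have hlt : ∀ k ∈ Finset.range n, projBlock V n f k =
      (V (k + 1)).starProjection f - (V k).starProjection f :=
    fun k hk => if_pos (Finset.mem_range.1 hk)
  rw [Finset.sum_range_succ, Finset.sum_congr rfl hlt,
    Finset.sum_range_sub (fun k => (V k).starProjection f), projBlock, if_neg (lt_irrefl n)]
  have : (V 0).starProjection f = 0 :=
    (Submodule.mem_bot ℝ).1 (h0.le ((V 0).starProjection_apply_mem f))
  rw [this]; abel

lemma projBlock_mem (hV : Monotone V) {n k : ℕ} (hk : k < n) (f : E) :
    projBlock V n f k ∈ V (k + 1) := by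
  rw [projBlock, if_pos hk]
  exact Submodule.sub_mem _ (Submodule.starProjection_apply_mem _ _)
    (hV k.le_succ (Submodule.starProjection_apply_mem _ _))

lemma inner_projBlock_eq_zero_of_mem (hV : Monotone V) {n k : ℕ} {w : E} (hw : w ∈ V k) (f : E) :
    inner ℝ (projBlock V n f k) w = 0 := by
  have h1 := Submodule.starProjection_inner_eq_zero (K := V k) f w hw
  have h2 := Submodule.starProjection_inner_eq_zero (K := V (k + 1)) f w (hV k.le_succ hw)
  rw [inner_sub_left] at h1 h2
  rw [projBlock]
  split_ifs <;> rw [inner_sub_left] <;> linarith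

lemma inner_projBlock_eq_zero (hV : Monotone V) {n k l : ℕ} (hk : k ≤ n) (hl : l ≤ n)
    (hkl : k ≠ l) (f : E) : inner ℝ (projBlock V n f k) (projBlock V n f l) = 0 := by
  rcases lt_or_gt_of_ne hkl with h | h
  · rw [real_inner_comm]
    exact inner_projBlock_eq_zero_of_mem hV (hV h (projBlock_mem hV (by omega) f)) f
  · exact inner_projBlock_eq_zero_of_mem hV (hV h (projBlock_mem hV (by omega) f)) f

lemma norm_projBlock_le (hV : Monotone V) {n k : ℕ} {w : E} (hw : w ∈ V k) (f : E) :
    ‖projBlock V n f k‖ ≤ ‖f - w‖ := by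
  have h : ‖f - (V k).starProjection f‖ ≤ ‖f - w‖ := by
    rw [Submodule.starProjection_minimal]
    exact ciInf_le ⟨0, by rintro _ ⟨_, rfl⟩; exact norm_nonneg _⟩ (⟨w, hw⟩ : V k)
  refine le_trans ?_ h
  rw [projBlock]
  split_ifs
  · have : (V (k + 1)).starProjection f - (V k).starProjection f
        = (V (k + 1)).starProjection (f - (V k).starProjection f) := by
      rw [map_sub, Submodule.starProjection_eq_self_iff.2
        (hV k.le_succ (Submodule.starProjection_apply_mem _ _))]
    rw [this]
    exact Submodule.norm_starProjection_apply_le _ _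
  · exact le_rfl

/-- The span of `τ (b₁, …, b_d)` with `bᵢ` in a basis of `V (κ i + 1)` and `∑ κ i < n`
(a hyperbolic cross). -/
lemma exists_hyperbolic_cross {e : ℕ} (τ : MultilinearMap ℝ (fun _ : Fin (e + 1) => E) G)
    {D : ℕ} (hD : ∀ k, Module.finrank ℝ (V (k + 1)) ≤ D * 2 ^ k) (n : ℕ) :
    ∃ W : Submodule ℝ G, FiniteDimensional ℝ W ∧
      Module.finrank ℝ W ≤ D ^ (e + 1) * (2 ^ n * (n + 1) ^ e) ∧
      ∀ κ ∈ (Fintype.piFinset fun _ : Fin (e + 1) => Finset.range (n + 1)).filter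
        (fun κ => ∑ i, κ i < n), ∀ f : Fin (e + 1) → E, (∀ i, f i ∈ V (κ i + 1)) → τ f ∈ W := by
  classical
  let K := (Fintype.piFinset fun _ : Fin (e + 1) => Finset.range (n + 1)).filter
    (fun κ => ∑ i, κ i < n)
  let b := fun k => Module.finBasis ℝ (V (k + 1))
  let S : Finset G := K.biUnion fun κ => Finset.univ.image
    fun j : (i : Fin (e + 1)) → Fin (Module.finrank ℝ (V (κ i + 1))) =>
      τ fun i => (b (κ i) (j i) : E)
  refine ⟨Submodule.span ℝ (S : Set G), FiniteDimensional.span_finset ℝ S, ?_, ?_⟩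
  · refine (finrank_span_finset_le_card S).trans (Finset.card_biUnion_le.trans ?_)
    refine le_trans (Finset.sum_le_sum fun κ _ => ?_)
      ((Finset.mul_sum K (fun κ => 2 ^ (∑ i, κ i)) (D ^ (e + 1))).symm.le.trans
        (Nat.mul_le_mul_left _ (sum_filter_lt_two_pow_le e n)))
    refine Finset.card_image_le.trans ?_
    rw [Finset.card_univ, Fintype.card_pi]
    calc ∏ i, Fintype.card (Fin (Module.finrank ℝ (V (κ i + 1))))
        ≤ ∏ i, D * 2 ^ κ i := Finset.prod_le_prod' fun i _ => by simpa using hD (κ i)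
      _ = _ := by rw [Finset.prod_mul_distrib, Finset.prod_pow_eq_pow_sum]; simp
  · intro κ hκ f hf
    have hf' : f = fun i => ∑ j, (b (κ i)).repr ⟨f i, hf i⟩ j • (b (κ i) j : E) := by
      funext i
      have h := congrArg (V (κ i + 1)).subtype ((b (κ i)).sum_repr ⟨f i, hf i⟩)
      rw [map_sum] at h
      exact h.symm
    rw [hf', MultilinearMap.map_sum]
    refine Submodule.sum_mem _ fun j _ => ?_
    rw [MultilinearMap.map_smul_univ]
    exact Submodule.smul_mem _ _ (Submodule.subset_span (Finset.mem_coe.2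
      (Finset.mem_biUnion.2 ⟨κ, hκ, Finset.mem_image_of_mem _ (Finset.mem_univ j)⟩)))

/-- Tensor products of blocks are pairwise orthogonal. -/
lemma norm_sum_map_projBlock_sq_le {e : ℕ} (τ : MultilinearMap ℝ (fun _ : Fin (e + 1) => E) G)
    (hτ : ∀ f g, inner ℝ (τ f) (τ g) = ∏ i, inner ℝ (f i) (g i)) (hV : Monotone V)
    {a B : ℝ} {n : ℕ} {f : Fin (e + 1) → E}
    (hf : ∀ i k, ∃ w ∈ V k, ‖f i - w‖ ^ 2 ≤ B * a ^ k) (s : Finset (Fin (e + 1) → ℕ))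
    (hs : ∀ κ ∈ s, ∀ i, κ i ≤ n) :
    ‖∑ κ ∈ s, τ fun i => projBlock V n (f i) (κ i)‖ ^ 2 ≤
      ∑ κ ∈ s, B ^ (e + 1) * a ^ (∑ i, κ i) := by
  rw [norm_sum_sq_of_pairwise_inner_eq_zero]
  · refine Finset.sum_le_sum fun κ _ => ?_
    rw [← real_inner_self_eq_norm_sq, hτ]
    calc _ ≤ ∏ i, B * a ^ κ i := by
          refine Finset.prod_le_prod (fun i _ => real_inner_self_nonneg) fun i _ => ?_
          obtain ⟨w, hw, h⟩ := hf i (κ i)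
          rw [real_inner_self_eq_norm_sq]
          exact (pow_le_pow_left₀ (norm_nonneg _) (norm_projBlock_le hV hw _) 2).trans h
      _ = _ := by rw [Finset.prod_mul_distrib, Finset.prod_pow_eq_pow_sum]; simp
  · intro κ hκ κ' hκ' hne
    obtain ⟨i, hi⟩ := Function.ne_iff.1 hne
    rw [hτ]
    exact Finset.prod_eq_zero (Finset.mem_univ i)
      (inner_projBlock_eq_zero hV (hs κ hκ i) (hs κ' hκ' i) hi _)

lemma exists_hyperbolic_cross_approx {e : ℕ} (τ : MultilinearMap ℝ (fun _ : Fin (e + 1) => E) G)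
    (hτ : ∀ f g, inner ℝ (τ f) (τ g) = ∏ i, inner ℝ (f i) (g i))
    (h0 : V 0 = ⊥) (hV : Monotone V)
    {D : ℕ} (hD : ∀ k, Module.finrank ℝ (V (k + 1)) ≤ D * 2 ^ k)
    {a B : ℝ} (ha : 0 ≤ a) (ha2 : a ≤ 1 / 2) (hB : 0 ≤ B) (n : ℕ) :
    ∃ W : Submodule ℝ G, FiniteDimensional ℝ W ∧
      Module.finrank ℝ W ≤ D ^ (e + 1) * (2 ^ n * (n + 1) ^ e) ∧
      ∀ f : Fin (e + 1) → E, (∀ i k, ∃ w ∈ V k, ‖f i - w‖ ^ 2 ≤ B * a ^ k) →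
        ∃ w ∈ W, ‖τ f - w‖ ^ 2 ≤ B ^ (e + 1) * (2 * (e + 1) ^ e) * (n + 1) ^ e * a ^ n := by
  obtain ⟨W, hWfin, hWdim, hW⟩ := exists_hyperbolic_cross (V := V) τ hD n
  refine ⟨W, hWfin, hWdim, fun f hf => ?_⟩
  have hsum : τ f = ∑ κ ∈ Fintype.piFinset fun _ : Fin (e + 1) => Finset.range (n + 1),
      τ fun i => projBlock V n (f i) (κ i) := by
    rw [← MultilinearMap.map_sum_finset τ (fun i k => projBlock V n (f i) k)]
    congr 1
    funext i
    exact (sum_projBlock h0 n (f i)).symm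
  refine ⟨∑ κ ∈ (Fintype.piFinset fun _ : Fin (e + 1) => Finset.range (n + 1)).filter
      (fun κ => ∑ i, κ i < n), τ fun i => projBlock V n (f i) (κ i),
      Submodule.sum_mem _ fun κ hκ => hW κ hκ _ fun i => ?_, ?_⟩
  · refine projBlock_mem hV (lt_of_le_of_lt ?_ (Finset.mem_filter.1 hκ).2) _
    exact Finset.single_le_sum (f := κ) (fun _ _ => Nat.zero_le _) (Finset.mem_univ i)
  · rw [hsum, ← Finset.sum_filter_add_sum_filter_not _ (fun κ => ∑ i, κ i < n),
      add_sub_cancel_left]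
    refine (norm_sum_map_projBlock_sq_le τ hτ hV hf _ fun κ hκ i =>
      Finset.mem_range_succ_iff.1 (Fintype.mem_piFinset.1 (Finset.mem_filter.1 hκ).1 i)).trans ?_
    rw [← Finset.mul_sum]
    calc _ ≤ B ^ (e + 1) * (2 * (e + 1) ^ e * (n + 1) ^ e * a ^ n) :=
          mul_le_mul_of_nonneg_left (sum_filter_ge_pow_le e n ha ha2) (pow_nonneg hB _)
      _ = _ := by ring

end TensorWidths

section TensorMap

variable {ι α : Type*} [Fintype ι] [MeasurableSpace α] {μ : Measure α} [SigmaFinite μ]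

lemma memLp_two_prod_eval {f : ι → α → ℝ} (hf : ∀ i, MemLp (f i) 2 μ) :
    MemLp (fun u : ι → α => ∏ i, f i (u i)) 2 (Measure.pi fun _ => μ) := by
  refine (memLp_two_iff_integrable_sq ?_).2 ?_
  · exact Finset.aestronglyMeasurable_fun_prod _ fun i _ =>
      (hf i).1.comp_quasiMeasurePreserving (Measure.quasiMeasurePreserving_eval _ i)
  · simp_rw [← Finset.prod_pow]
    exact Integrable.fintype_prod fun i => (hf i).integrable_sq

lemma prod_eval_ae_congr {f g : ι → α → ℝ} (h : ∀ i, f i =ᵐ[μ] g i) :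
    (fun u : ι → α => ∏ i, f i (u i)) =ᵐ[Measure.pi fun _ => μ] fun u => ∏ i, g i (u i) := by
  have h1 : ∀ᵐ u : ι → α ∂(Measure.pi fun _ => μ), ∀ i, f i (u i) = g i (u i) :=
    ae_all_iff.2 fun i =>
      (Measure.tendsto_eval_ae_ae (μ := fun _ : ι => μ) (i := i)).eventually (h i)
  filter_upwards [h1] with u hu
  exact Finset.prod_congr rfl fun i _ => hu i

/-- The tensor product `(f_i)_i ↦ (u ↦ ∏ i, f_i (u_i))` of square integrable functions. -/
noncomputable def tensorLp [DecidableEq ι] (μ : Measure α) [SigmaFinite μ] :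
    MultilinearMap ℝ (fun _ : ι => Lp ℝ 2 μ) (Lp ℝ 2 (Measure.pi fun _ : ι => μ)) :=
  MultilinearMap.mk' (fun f => (memLp_two_prod_eval fun i => Lp.memLp (f i)).toLp)
    (fun f i x y => by
      refine Eq.trans ?_ (MemLp.toLp_add _ _)
      refine MemLp.toLp_congr _ _ ?_
      refine (prod_eval_ae_congr (g := Function.update (fun j => (f j : α → ℝ)) i
        ((x : α → ℝ) + y)) fun j => ?_).trans (.of_forall fun u => ?_)
      · by_cases hj : j = i
        · subst hj
          simpa using Lp.coeFn_add x y
        · simp [hj]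
      · simp only [Pi.add_apply]
        rw [← Finset.mul_prod_erase _ _ (Finset.mem_univ i),
          ← Finset.mul_prod_erase _ _ (Finset.mem_univ i),
          ← Finset.mul_prod_erase _ _ (Finset.mem_univ i)]
        simp only [Function.update_self, Pi.add_apply, add_mul]
        congr 2 <;>
        · refine Finset.prod_congr rfl fun j hj => ?_
          simp [Finset.ne_of_mem_erase hj])
    (fun f i c x => by
      refine Eq.trans ?_ (MemLp.toLp_const_smul _ _)
      refine MemLp.toLp_congr _ _ ?_
      refine (prod_eval_ae_congr (g := Function.update (fun j => (f j : α → ℝ)) i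
        (c • (x : α → ℝ))) fun j => ?_).trans (.of_forall fun u => ?_)
      · by_cases hj : j = i
        · subst hj
          simpa using Lp.coeFn_smul c x
        · simp [hj]
      · simp only [Pi.smul_apply, smul_eq_mul]
        rw [← Finset.mul_prod_erase _ _ (Finset.mem_univ i),
          ← Finset.mul_prod_erase _ _ (Finset.mem_univ i)]
        simp only [Function.update_self, Pi.smul_apply, smul_eq_mul, mul_assoc]
        congr 2
        refine Finset.prod_congr rfl fun j hj => ?_
        simp [Finset.ne_of_mem_erase hj])

lemma coeFn_tensorLp [DecidableEq ι] {f : ι → Lp ℝ 2 μ} {φ : ι → α → ℝ}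
    (h : ∀ i, f i =ᵐ[μ] φ i) :
    tensorLp μ f =ᵐ[Measure.pi fun _ => μ] fun u => ∏ i, φ i (u i) :=
  (MemLp.coeFn_toLp (memLp_two_prod_eval fun i => Lp.memLp (f i))).trans (prod_eval_ae_congr h)

lemma inner_tensorLp [DecidableEq ι] (f g : ι → Lp ℝ 2 μ) :
    inner ℝ (tensorLp μ f) (tensorLp μ g) = ∏ i, inner ℝ (f i) (g i) := by
  simp only [L2.inner_def]
  rw [← integral_fintype_prod_eq_prod (μ := fun _ : ι => μ)
    (fun i x => inner ℝ ((f i : α → ℝ) x) ((g i : α → ℝ) x))]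
  refine integral_congr_ae ?_
  filter_upwards [coeFn_tensorLp (f := f) fun i => .rfl,
    coeFn_tensorLp (f := g) fun i => .rfl] with u hu hv
  simp [hu, hv, Finset.prod_mul_distrib]

lemma norm_tensorLp [DecidableEq ι] (f : ι → Lp ℝ 2 μ) : ‖tensorLp μ f‖ = ∏ i, ‖f i‖ := by
  rw [← Real.sqrt_sq (norm_nonneg (tensorLp μ f)), ← real_inner_self_eq_norm_sq, inner_tensorLp]
  simp only [real_inner_self_eq_norm_sq]
  rw [Finset.prod_pow, Real.sqrt_sq (Finset.prod_nonneg fun i _ => norm_nonneg _)]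

lemma norm_tensorLp_sub_le [DecidableEq ι] {f g : ι → Lp ℝ 2 μ} {δ : ℝ} (hδ : 0 ≤ δ)
    (hf : ∀ i, ‖f i‖ ≤ 1) (hg : ∀ i, ‖g i‖ ≤ 1) (h : ∀ i, ‖f i - g i‖ ≤ δ) :
    ‖tensorLp μ f - tensorLp μ g‖ ≤ Fintype.card ι * δ := by
  refine ((tensorLp μ).norm_image_sub_le_of_bound zero_le_one
    (fun m => by rw [norm_tensorLp, one_mul]) f g).trans ?_
  have h1 : max ‖f‖ ‖g‖ ≤ 1 := max_le ((pi_norm_le_iff_of_nonneg zero_le_one).2 hf)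
    ((pi_norm_le_iff_of_nonneg zero_le_one).2 hg)
  have h2 : ‖f - g‖ ≤ δ := (pi_norm_le_iff_of_nonneg hδ).2 h
  rw [one_mul]
  refine mul_le_mul ?_ h2 (norm_nonneg _) (by positivity)
  exact mul_le_of_le_one_right (by positivity)
    (pow_le_one₀ ((norm_nonneg f).trans (le_max_left _ _)) h1)

end TensorMap

section TruncPow

/-- Lebesgue measure on the unit interval. -/
noncomputable abbrev unitVol : Measure ℝ := (volume : Measure ℝ).restrict (Set.Icc (0:ℝ) 1)

instance : IsProbabilityMeasure unitVol := ⟨by simp⟩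

lemma truncPow_eq (n : ℕ) (t : ℝ) : truncPow n t = if 0 ≤ t then t ^ n else 0 := by
  unfold truncPow
  by_cases hn : n = 0
  · simp [hn]
  · by_cases ht : 0 ≤ t
    · simp [hn, ht]
    · simp [hn, ht, max_eq_right (not_le.1 ht).le]

lemma abs_truncPow_le_one (n : ℕ) {t : ℝ} (ht : t ≤ 1) : |truncPow n t| ≤ 1 := by
  rw [truncPow_eq]
  split_ifs with h
  · rw [abs_of_nonneg (pow_nonneg h n)]
    exact pow_le_one₀ h ht
  · simp

lemma norm_toLp_sq {f : ℝ → ℝ} (hf : MemLp f 2 unitVol) :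
    ‖hf.toLp f‖ ^ 2 = ∫ u, f u ^ 2 ∂unitVol := by
  rw [← real_inner_self_eq_norm_sq, L2.inner_def]
  refine integral_congr_ae ?_
  filter_upwards [hf.coeFn_toLp] with u hu
  simp [hu, sq]

lemma norm_toLp_sub_toLp_sq {f g : ℝ → ℝ} (hf : MemLp f 2 unitVol) (hg : MemLp g 2 unitVol) :
    ‖hf.toLp f - hg.toLp g‖ ^ 2 = ∫ u, (f u - g u) ^ 2 ∂unitVol := by
  rw [← MemLp.toLp_sub, norm_toLp_sq]
  rfl

/-- A squared `L²` distance is controlled by a bound that is a constant plus a multiple of the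
indicator of an interval. -/
lemma norm_toLp_sub_toLp_sq_le {f g : ℝ → ℝ} (hf : MemLp f 2 unitVol) (hg : MemLp g 2 unitVol)
    {A B a b : ℝ} (hB : 0 ≤ B) (hab : a ≤ b)
    (h : ∀ u ∈ Set.Icc (0:ℝ) 1, (f u - g u) ^ 2 ≤ A + (Set.Icc a b).indicator (fun _ => B) u) :
    ‖hf.toLp f - hg.toLp g‖ ^ 2 ≤ A + B * (b - a) := by
  rw [norm_toLp_sub_toLp_sq]
  have hI : Integrable ((Set.Icc a b).indicator fun _ => B) unitVol :=
    (integrable_const B).indicator measurableSet_Icc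
  calc _ ≤ ∫ u, A + (Set.Icc a b).indicator (fun _ => B) u ∂unitVol := by
        refine integral_mono_ae (hf.sub hg).integrable_sq ((integrable_const A).add hI) ?_
        exact (ae_restrict_iff' measurableSet_Icc).2 (.of_forall h)
    _ = A + unitVol.real (Set.Icc a b) * B := by
        rw [integral_add (integrable_const A) hI, integral_indicator_const _ measurableSet_Icc]
        simp
    _ ≤ _ := by
        rw [mul_comm]
        gcongr
        calc unitVol.real (Set.Icc a b) ≤ volume.real (Set.Icc a b) :=
              ENNReal.toReal_mono (by simp) (Measure.restrict_apply_le _ _)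
          _ = b - a := by simp [Real.volume_real_Icc_of_le hab]

lemma memLp_cutPoly (c : ℝ) (p : Polynomial ℝ) :
    MemLp (fun u => if c ≤ u then p.eval u else 0) 2 unitVol := by
  obtain ⟨K, hK⟩ := isCompact_Icc.exists_bound_of_continuousOn
    (p.continuous.continuousOn (s := Set.Icc (0:ℝ) 1))
  refine MemLp.of_bound (C := K) ?_ ?_
  · exact (Measurable.ite measurableSet_Ici p.continuous.measurable
      measurable_const).aestronglyMeasurable
  · refine (ae_restrict_iff' measurableSet_Icc).2 (.of_forall fun u hu => ?_)
    split_ifs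
    · exact hK u hu
    · simpa using (norm_nonneg _).trans (hK u hu)

/-- The polynomial `p` set to zero to the left of `c`, as an element of `L²([0,1])`. -/
noncomputable def cutPoly (c : ℝ) : Polynomial ℝ →ₗ[ℝ] Lp ℝ 2 unitVol where
  toFun p := (memLp_cutPoly c p).toLp
  map_add' p r := by
    rw [← MemLp.toLp_add]
    refine MemLp.toLp_congr _ _ (.of_forall fun u => ?_)
    by_cases h : c ≤ u <;> simp [h]
  map_smul' a p := by
    rw [RingHom.id_apply, ← MemLp.toLp_const_smul]
    refine MemLp.toLp_congr _ _ (.of_forall fun u => ?_)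
    by_cases h : c ≤ u <;> simp [h]

lemma truncPow_sub_eq_cutPoly (n : ℕ) (v u : ℝ) : truncPow n (u - v) =
    if v ≤ u then ((Polynomial.X - Polynomial.C v) ^ n).eval u else 0 := by
  simp [truncPow_eq]

/-- The truncated power `u ↦ ((u - v)₊)ⁿ` as an element of `L²([0,1])`. -/
noncomputable def truncPowLp (n : ℕ) (v : ℝ) : Lp ℝ 2 unitVol :=
  cutPoly v ((Polynomial.X - Polynomial.C v) ^ n)

lemma coeFn_truncPowLp (n : ℕ) (v : ℝ) :
    truncPowLp n v =ᵐ[unitVol] fun u => truncPow n (u - v) := by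
  simp_rw [truncPow_sub_eq_cutPoly]
  exact MemLp.coeFn_toLp (memLp_cutPoly v _)

lemma truncPowLp_sub_cutPoly_sq_le (n : ℕ) {v c : ℝ} (h : v ≤ c) :
    ‖truncPowLp n v - cutPoly c ((Polynomial.X - Polynomial.C v) ^ n)‖ ^ 2 ≤
      (c - v) ^ (2 * n + 1) := by
  refine (norm_toLp_sub_toLp_sq_le (memLp_cutPoly v _) (memLp_cutPoly c _) (A := 0)
    (B := (c - v) ^ (2 * n)) (a := v) (b := c) (by have := sub_nonneg.2 h; positivity) h
    fun u _ => ?_).trans_eq (by ring)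
  by_cases h1 : c ≤ u
  · rw [if_pos (h.trans h1), if_pos h1, sub_self, zero_pow two_ne_zero, zero_add]
    exact Set.indicator_nonneg (fun _ _ => by have := sub_nonneg.2 h; positivity) _
  by_cases h2 : v ≤ u
  · rw [if_pos h2, if_neg h1, Set.indicator_of_mem (Set.mem_Icc.2 ⟨h2, (not_le.1 h1).le⟩)]
    simp only [Polynomial.eval_pow, Polynomial.eval_sub, Polynomial.eval_X, Polynomial.eval_C,
      sub_zero, zero_add, ← pow_mul]
    rw [mul_comm n]
    exact pow_le_pow_left₀ (sub_nonneg.2 h2) (by linarith) _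
  · simp only [if_neg h1, if_neg h2, sub_self, zero_pow two_ne_zero, zero_add]
    exact Set.indicator_nonneg (fun _ _ => by have := sub_nonneg.2 h; positivity) _

lemma norm_truncPowLp_le_one (n : ℕ) {v : ℝ} (hv : 0 ≤ v) : ‖truncPowLp n v‖ ≤ 1 := by
  have h1 : ‖truncPowLp n v‖ ^ 2 ≤ 1 := by
    rw [truncPowLp]
    refine (norm_toLp_sq (memLp_cutPoly v _)).trans_le ?_
    calc _ ≤ ∫ _, (1:ℝ) ∂unitVol := by
          refine integral_mono_ae (memLp_cutPoly v _).integrable_sq (integrable_const 1) ?_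
          refine (ae_restrict_iff' measurableSet_Icc).2 (.of_forall fun u hu => ?_)
          simp only [← truncPow_sub_eq_cutPoly]
          exact (sq_le_one_iff_abs_le_one _).2
            (abs_truncPow_le_one n (by linarith [hu.2]))
      _ = 1 := by simp
  exact (sq_le_one_iff₀ (norm_nonneg _)).1 h1

lemma truncPowLp_sub_truncPowLp_sq_le (n : ℕ) {v w : ℝ} (hv : 0 ≤ v) (hvw : v ≤ w) (hw : w ≤ 1) :
    ‖truncPowLp n v - truncPowLp n w‖ ^ 2 ≤ (n + 1) ^ 2 * (w - v) := by
  have h0 : 0 ≤ w - v := sub_nonneg.2 hvw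
  refine (norm_toLp_sub_toLp_sq_le (memLp_cutPoly v _) (memLp_cutPoly w _)
    (A := n ^ 2 * (w - v) ^ 2) (B := 1) (a := v) (b := w) zero_le_one hvw
    fun u hu => ?_).trans ?_
  · simp only [← truncPow_sub_eq_cutPoly, truncPow_eq, sub_nonneg]
    have hi : 0 ≤ (Set.Icc v w).indicator (fun _ => (1:ℝ)) u :=
      Set.indicator_nonneg (fun _ _ => zero_le_one) _
    by_cases h1 : w ≤ u
    · rw [if_pos (hvw.trans h1), if_pos h1]
      refine le_add_of_le_of_nonneg ?_ hi
      rw [← mul_pow, ← sq_abs]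
      refine pow_le_pow_left₀ (abs_nonneg _) ?_ 2
      refine (abs_pow_sub_pow_le _ _ n).trans ?_
      have h2 : |u - v - (u - w)| = w - v := by
        rw [show u - v - (u - w) = w - v by ring, abs_of_nonneg h0]
      have h3 : max |u - v| |u - w| ≤ 1 := by
        refine max_le (abs_le.2 ⟨?_, ?_⟩) (abs_le.2 ⟨?_, ?_⟩) <;> linarith [hu.1, hu.2]
      rw [h2, mul_comm (n : ℝ)]
      exact mul_le_of_le_one_right (by positivity)
        (pow_le_one₀ ((abs_nonneg _).trans (le_max_left _ _)) h3)
    by_cases h2 : v ≤ u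
    · rw [if_pos h2, if_neg h1, Set.indicator_of_mem (Set.mem_Icc.2 ⟨h2, (not_le.1 h1).le⟩), sub_zero]
      refine le_add_of_nonneg_of_le (by positivity) ?_
      exact pow_le_one₀ (pow_nonneg (sub_nonneg.2 h2) _)
        (pow_le_one₀ (sub_nonneg.2 h2) (by linarith [hu.2]))
    · rw [if_neg h1, if_neg h2, sub_zero, zero_pow two_ne_zero]
      positivity
  · have h1 : (w - v) ^ 2 ≤ w - v := by nlinarith
    have h2 : (n : ℝ) ^ 2 * (w - v) ^ 2 ≤ n ^ 2 * (w - v) := by gcongr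
    have h3 : 0 ≤ (n : ℝ) * (w - v) := by positivity
    nlinarith

end TruncPow

section SplineSpace

open Polynomial

/-- Piecewise polynomials of degree `< q` with knots in `2⁻ᵏ ℤ` (at index `k + 1`), and the trivial
space at index `0`. -/
noncomputable def splineSpace (q : ℕ) : ℕ → Submodule ℝ (Lp ℝ 2 unitVol)
  | 0 => ⊥
  | k + 1 => Submodule.span ℝ (Set.range fun x : Fin (2 ^ (k + 1) + 1) × Fin q =>
      cutPoly (((x.1 : ℕ) : ℝ) / 2 ^ k) (X ^ (x.2 : ℕ)))

instance (q k : ℕ) : FiniteDimensional ℝ (splineSpace q k) := by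
  cases k with
  | zero => exact inferInstanceAs (FiniteDimensional ℝ (⊥ : Submodule ℝ (Lp ℝ 2 unitVol)))
  | succ k => exact FiniteDimensional.span_of_finite ℝ (Set.finite_range _)

lemma cutPoly_X_pow_mem_splineSpace {q k i j : ℕ} (hi : i ≤ 2 ^ (k + 1)) (hj : j < q) :
    cutPoly ((i : ℝ) / 2 ^ k) (X ^ j) ∈ splineSpace q (k + 1) :=
  Submodule.subset_span ⟨(⟨i, Nat.lt_succ_of_le hi⟩, ⟨j, hj⟩), rfl⟩

lemma cutPoly_mem_splineSpace {q k i : ℕ} (hi : i ≤ 2 ^ (k + 1)) {p : ℝ[X]}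
    (hp : p.natDegree < q) : cutPoly ((i : ℝ) / 2 ^ k) p ∈ splineSpace q (k + 1) := by
  rw [p.as_sum_range' q hp, map_sum]
  refine Submodule.sum_mem _ fun j hj => ?_
  rw [← C_mul_X_pow_eq_monomial, ← smul_eq_C_mul, map_smul]
  exact Submodule.smul_mem _ _ (cutPoly_X_pow_mem_splineSpace hi (Finset.mem_range.1 hj))

lemma monotone_splineSpace (q : ℕ) : Monotone (splineSpace q) := by
  refine monotone_nat_of_le_succ fun k => ?_
  cases k with
  | zero => exact bot_le
  | succ k =>
    refine Submodule.span_le.2 fun x hx => ?_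
    obtain ⟨⟨⟨i, hi⟩, j⟩, rfl⟩ := hx
    have h : ((i : ℝ) / 2 ^ k) = ((2 * i : ℕ) : ℝ) / 2 ^ (k + 1) := by
      push_cast
      rw [pow_succ']
      field_simp
    simp only [h]
    refine cutPoly_X_pow_mem_splineSpace ?_ j.2
    rw [pow_succ']
    omega

lemma finrank_splineSpace_succ_le (q k : ℕ) :
    Module.finrank ℝ (splineSpace q (k + 1)) ≤ 3 * q * 2 ^ k := by
  refine (finrank_range_le_card (R := ℝ) fun x : Fin (2 ^ (k + 1) + 1) × Fin q =>
    cutPoly (((x.1 : ℕ) : ℝ) / 2 ^ k) (X ^ (x.2 : ℕ))).trans ?_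
  rw [Fintype.card_prod, Fintype.card_fin, Fintype.card_fin, pow_succ]
  have : 1 ≤ 2 ^ k := Nat.one_le_two_pow
  calc _ ≤ (3 * 2 ^ k) * q := Nat.mul_le_mul_right q (by omega)
    _ = _ := by ring

lemma exists_splineSpace_approx {q : ℕ} (hq : 1 ≤ q) {v : ℝ} (hv : v ∈ Set.Icc (0:ℝ) 1) (k : ℕ) :
    ∃ w ∈ splineSpace q k, ‖truncPowLp (q - 1) v - w‖ ^ 2 ≤
      2 ^ (2 * q - 1) * ((1 / 2 : ℝ) ^ (2 * q - 1)) ^ k := by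
  cases k with
  | zero =>
    refine ⟨0, Submodule.zero_mem _, ?_⟩
    rw [sub_zero, pow_zero, mul_one]
    exact (pow_le_one₀ (norm_nonneg _) (norm_truncPowLp_le_one _ hv.1)).trans
      (one_le_pow₀ one_le_two)
  | succ k =>
    have hk : (0:ℝ) < 2 ^ k := by positivity
    set i := ⌊2 ^ k * v⌋₊ + 1 with hi
    have h1 : v ≤ (i : ℝ) / 2 ^ k := by
      rw [le_div_iff₀ hk, mul_comm, hi]
      push_cast
      exact (Nat.lt_floor_add_one _).le
    have h2 : (i : ℝ) / 2 ^ k - v ≤ 1 / 2 ^ k := by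
      rw [sub_le_iff_le_add, div_le_iff₀ hk, add_mul, one_div_mul_cancel hk.ne', hi]
      push_cast
      linarith [Nat.floor_le (mul_nonneg hk.le hv.1)]
    have h3 : i ≤ 2 ^ (k + 1) := by
      have : ⌊2 ^ k * v⌋₊ ≤ 2 ^ k :=
        Nat.floor_le_of_le (by push_cast; exact mul_le_of_le_one_right hk.le hv.2)
      have : 1 ≤ 2 ^ k := Nat.one_le_two_pow
      rw [pow_succ]
      omega
    refine ⟨_, cutPoly_mem_splineSpace (p := (X - C v) ^ (q - 1)) h3 ?_,
      (truncPowLp_sub_cutPoly_sq_le _ h1).trans ?_⟩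
    · rw [natDegree_pow, natDegree_X_sub_C]
      omega
    · rw [show 2 * (q - 1) + 1 = 2 * q - 1 by omega]
      refine (pow_le_pow_left₀ (sub_nonneg.2 h1) h2 _).trans_eq ?_
      rw [pow_succ, mul_left_comm, ← mul_pow 2 (1 / 2 : ℝ), mul_one_div_cancel two_ne_zero,
        one_pow, mul_one, ← one_div_pow, ← pow_mul, ← pow_mul, mul_comm k]

end SplineSpace

section Assembly

lemma exists_mem_absConvSpan_near {G α ι : Type*} [NormedAddCommGroup G] [InnerProductSpace ℝ G]
    [Fintype ι] {s : Finset α} {β : α → ℝ} (hβ : ∑ v ∈ s, |β v| ≤ 1) {ψ : α → G} {φ : ι → G}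
    {r : α → ι} {δ : ℝ} (hδ : 0 ≤ δ) (h : ∀ v ∈ s, ‖ψ v - φ (r v)‖ ≤ δ) :
    ∃ x ∈ absConvSpan φ, ‖∑ v ∈ s, β v • ψ v - x‖ ≤ δ := by
  classical
  refine ⟨∑ v ∈ s, β v • φ (r v), ⟨fun i => ∑ v ∈ s with r v = i, β v, ?_, ?_⟩, ?_⟩
  · calc _ ≤ ∑ i, ∑ v ∈ s with r v = i, |β v| :=
          Finset.sum_le_sum fun i _ => Finset.abs_sum_le_sum_abs _ _
      _ = ∑ v ∈ s, |β v| := Finset.sum_fiberwise s r _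
      _ ≤ 1 := hβ
  · rw [← Finset.sum_fiberwise s r]
    refine Finset.sum_congr rfl fun i _ => ?_
    rw [Finset.sum_smul]
    exact Finset.sum_congr rfl fun v hv => by rw [(Finset.mem_filter.1 hv).2]
  · rw [← Finset.sum_sub_distrib]
    calc _ ≤ ∑ v ∈ s, ‖β v • ψ v - β v • φ (r v)‖ := norm_sum_le _ _
      _ ≤ ∑ v ∈ s, |β v| * δ := by
          refine Finset.sum_le_sum fun v hv => ?_
          rw [← smul_sub, norm_smul, Real.norm_eq_abs]
          exact mul_le_mul_of_nonneg_left (h v hv) (abs_nonneg _)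
      _ ≤ δ := by
          rw [← Finset.sum_mul]
          exact mul_le_of_le_one_left hδ hβ

/-- The dictionary element `u ↦ ∏ i, ((u_i - v_i)₊)ⁿ` as an element of `L²([0,1]^d)`. -/
noncomputable def tensorTruncPow (n : ℕ) {d : ℕ} (v : Fin d → ℝ) :
    Lp ℝ 2 (Measure.pi fun _ : Fin d => unitVol) :=
  tensorLp unitVol fun i => truncPowLp n (v i)

lemma norm_tensorTruncPow_le_one (n : ℕ) {d : ℕ} {v : Fin d → ℝ} (hv : ∀ i, 0 ≤ v i) :
    ‖tensorTruncPow n v‖ ≤ 1 := by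
  rw [tensorTruncPow, norm_tensorLp]
  exact Finset.prod_le_one (fun _ _ => norm_nonneg _) fun i _ => norm_truncPowLp_le_one n (hv i)

lemma norm_truncPowLp_sub_le (n : ℕ) {v w δ : ℝ} (hv : v ∈ Set.Icc (0:ℝ) 1)
    (hw : w ∈ Set.Icc (0:ℝ) 1) (h : |v - w| ≤ δ) :
    ‖truncPowLp n v - truncPowLp n w‖ ≤ (n + 1) * √δ := by
  wlog hvw : v ≤ w generalizing v w
  · rw [norm_sub_rev]
    exact this hw hv (by rwa [abs_sub_comm]) (le_of_not_ge hvw)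
  have hδ : 0 ≤ δ := (abs_nonneg _).trans h
  refine (sq_le_sq₀ (norm_nonneg _) (by positivity)).1 ?_
  rw [mul_pow, Real.sq_sqrt hδ]
  refine (truncPowLp_sub_truncPowLp_sq_le n hv.1 hvw hw.2).trans ?_
  rw [abs_sub_comm] at h
  gcongr
  exact (le_abs_self _).trans h

lemma norm_tensorTruncPow_sub_le (n : ℕ) {d : ℕ} {v w : Fin d → ℝ} {δ : ℝ}
    (hv : ∀ i, v i ∈ Set.Icc (0:ℝ) 1) (hw : ∀ i, w i ∈ Set.Icc (0:ℝ) 1)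
    (h : ∀ i, |v i - w i| ≤ δ) :
    ‖tensorTruncPow n v - tensorTruncPow n w‖ ≤ d * ((n + 1) * √δ) := by
  refine (norm_tensorLp_sub_le (δ := (n + 1) * √δ) (by positivity)
    (fun i => norm_truncPowLp_le_one n (hv i).1) (fun i => norm_truncPowLp_le_one n (hw i).1)
    fun i => norm_truncPowLp_sub_le n (hv i) (hw i) (h i)).trans_eq ?_
  rw [Fintype.card_fin]

lemma eq_sum_smul_tensorTruncPow {n d : ℕ} {s : Finset (Fin d → ℝ)} {β : (Fin d → ℝ) → ℝ}
    {g : Lp ℝ 2 (Measure.pi fun _ : Fin d => unitVol)}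
    (hg : g =ᵐ[Measure.pi fun _ : Fin d => unitVol]
      fun u => ∑ v ∈ s, β v * ∏ i, truncPow n (u i - v i)) :
    g = ∑ v ∈ s, β v • tensorTruncPow n v := by
  refine Lp.ext (hg.trans ?_)
  have h1 : ∀ v : Fin d → ℝ, (β v • tensorTruncPow n v :
      Lp ℝ 2 (Measure.pi fun _ : Fin d => unitVol)) =ᵐ[Measure.pi fun _ : Fin d => unitVol]
      fun u => β v * ∏ i, truncPow n (u i - v i) := fun v => by
    filter_upwards [Lp.coeFn_smul (β v) (tensorTruncPow n v),
      coeFn_tensorLp fun i => coeFn_truncPowLp n (v i)] with u h2 h3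
    rw [h2, Pi.smul_apply, smul_eq_mul]
    exact congrArg _ h3
  have h2 : ∀ᵐ u ∂(Measure.pi fun _ : Fin d => unitVol), ∀ v ∈ s,
      (β v • tensorTruncPow n v : Lp ℝ 2 (Measure.pi fun _ : Fin d => unitVol)) u =
        β v * ∏ i, truncPow n (u i - v i) :=
    (ae_ball_iff s.countable_toSet).2 fun v _ => h1 v
  filter_upwards [h2, Lp.coeFn_finsetSum s fun v => β v • tensorTruncPow n v] with u hu hs
  rw [hs, Finset.sum_apply]
  exact Finset.sum_congr rfl fun v hv => (hu v hv).symm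

lemma hasWidthBound_tensorTruncPow {q : ℕ} (hq : 1 ≤ q) (e : ℕ) {ι : Type*}
    {v : ι → Fin (e + 1) → ℝ} (hv : ∀ j i, v j i ∈ Set.Icc (0:ℝ) 1) :
    HasWidthBound q e ((3 * q) ^ (e + 1)) ((2 ^ (2 * q - 1)) ^ (e + 1) * (2 * (e + 1) ^ e))
      fun j => tensorTruncPow (q - 1) (v j) := by
  intro n
  obtain ⟨W, hW, hdim, hw⟩ := exists_hyperbolic_cross_approx (e := e) (V := splineSpace q)
    (tensorLp unitVol) inner_tensorLp rfl (monotone_splineSpace q) (finrank_splineSpace_succ_le q)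
    (a := (1 / 2) ^ (2 * q - 1)) (B := 2 ^ (2 * q - 1)) (by positivity)
    ((pow_le_pow_of_le_one (by norm_num) (by norm_num) (by omega : 1 ≤ 2 * q - 1)).trans_eq
      (pow_one _)) (by positivity) n
  refine ⟨W, hW, by exact_mod_cast hdim, fun j => ?_⟩
  obtain ⟨w, hwW, h⟩ := hw (fun i => truncPowLp (q - 1) (v j i))
    fun i k => exists_splineSpace_approx hq (hv j i) k
  exact ⟨w, hwW, h.trans_eq (by rw [pow_mul])⟩

lemma exists_grid_near {M : ℕ} (hM : 0 < M) {v : ℝ} (hv : v ∈ Set.Icc (0:ℝ) 1) :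
    ∃ j : Fin (M + 1), |v - (j : ℕ) / M| ≤ 1 / M := by
  have hM' : (0:ℝ) < M := Nat.cast_pos.2 hM
  have h0 : 0 ≤ (M : ℝ) * v := mul_nonneg hM'.le hv.1
  refine ⟨⟨⌊M * v⌋₊, Nat.lt_succ_of_le (Nat.floor_le_of_le (mul_le_of_le_one_right hM'.le hv.2))⟩,
    ?_⟩
  have h1 := Nat.floor_le h0
  have h2 := Nat.lt_floor_add_one ((M : ℝ) * v)
  rw [show v - (⌊M * v⌋₊ : ℝ) / M = (M * v - ⌊M * v⌋₊) / M by field_simp, abs_div,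
    abs_of_pos hM', abs_of_nonneg (by linarith)]
  gcongr
  linarith

lemma log_card_grid_le {K ε : ℝ} (hK : 0 ≤ K) (hε : ε ∈ Set.Ioc 0 (Real.exp (-1))) (d : ℕ) :
    Real.log (2 * (⌈K / ε ^ 2⌉₊ + 1 : ℝ) ^ d + 1) ≤
      (Real.log (3 * (K + 2) ^ d) + 2 * d) * Real.log (1 / ε) := by
  have hε0 : 0 < ε := hε.1
  have hε1 : ε ≤ 1 := hε.2.trans (by simp)
  have hL : 1 ≤ Real.log (1 / ε) := by
    rw [one_div, Real.log_inv]
    have := Real.log_le_log hε0 hε.2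
    rw [Real.log_exp] at this
    linarith
  have h1 : (⌈K / ε ^ 2⌉₊ + 1 : ℝ) ≤ (K + 2) * (1 / ε) ^ 2 := by
    have h2 := (Nat.ceil_lt_add_one (show 0 ≤ K / ε ^ 2 by positivity)).le
    have h3 : 1 ≤ (1 / ε) ^ 2 := one_le_pow₀ ((one_le_div hε0).2 hε1)
    have h4 : K / ε ^ 2 = K * (1 / ε) ^ 2 := by ring
    linarith
  have h5 : (1:ℝ) ≤ (K + 2) * (1 / ε) ^ 2 :=
    le_trans (by linarith [Nat.cast_nonneg (α := ℝ) ⌈K / ε ^ 2⌉₊]) h1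
  have h6 : 1 ≤ 3 * (K + 2) ^ d := by
    have : 1 ≤ (K + 2) ^ d := one_le_pow₀ (by linarith)
    linarith
  calc _ ≤ Real.log (3 * (K + 2) ^ d * (1 / ε) ^ (2 * d)) := by
        refine Real.log_le_log (by positivity) ?_
        have h7 : (⌈K / ε ^ 2⌉₊ + 1 : ℝ) ^ d ≤ ((K + 2) * (1 / ε) ^ 2) ^ d := by gcongr
        have h8 : 1 ≤ ((K + 2) * (1 / ε) ^ 2) ^ d := one_le_pow₀ h5
        have h9 : 3 * (K + 2) ^ d * (1 / ε) ^ (2 * d) = 3 * ((K + 2) * (1 / ε) ^ 2) ^ d := by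
          rw [mul_pow, pow_mul, mul_assoc]
        linarith
    _ = Real.log (3 * (K + 2) ^ d) * 1 + 2 * d * Real.log (1 / ε) := by
        rw [Real.log_mul (by positivity) (by positivity), Real.log_pow]
        push_cast
        ring
    _ ≤ _ := by
        rw [add_mul]
        gcongr
        exact Real.log_nonneg h6

lemma covN_closure_le {E : Type*} [PseudoMetricSpace E] {ε : ℝ} {T : Set E} {t : Finset E}
    (h : ∀ x ∈ T, ∃ c ∈ t, dist x c ≤ ε) : covN ε (closure T) ≤ t.card := by
  refine sInf_le ⟨t, rfl, closure_minimal (fun x hx => ?_) ?_⟩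
  · obtain ⟨c, hc, hxc⟩ := h x hx
    exact Set.mem_biUnion hc (Metric.mem_closedBall.2 hxc)
  · exact t.finite_toSet.isClosed_biUnion fun c _ => Metric.isClosed_closedBall

end Assembly

/-- Let `F ⊆ L²([0,1]^d)` be the closure of the absolute convex hull of the
`d`-fold tensor products `u ↦ Π_i (u_i − v_i)₊^{q−1}` of the truncated power dictionary.  Then
`H(ε,F) ≤ C ε^{-1/q} (log(1/ε))^{d-1} (log(1/ε))^{1/(2q)}` for all small `ε`, with `C, ε₀`
depending only on `q` and `d`. -/
theorem entropy_truncPow_tensor (q d : ℕ) (hq : 1 ≤ q) (hd : 1 ≤ d) :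
    ∃ C > (0:ℝ), ∃ ε₀ ∈ Set.Ioc (0:ℝ) (1/2),
      ∀ ε ∈ Set.Ioc (0:ℝ) ε₀,
        covN ε (closure {g : Lp ℝ 2 (Measure.pi fun _ : Fin d =>
              (volume : Measure ℝ).restrict (Set.Icc (0:ℝ) 1)) |
            ∃ (s : Finset (Fin d → ℝ)) (β : (Fin d → ℝ) → ℝ),
              (∀ v ∈ s, ∀ i, v i ∈ Set.Icc (0:ℝ) 1) ∧ (∑ v ∈ s, |β v|) ≤ 1 ∧
              (g : (Fin d → ℝ) → ℝ)
                =ᵐ[Measure.pi fun _ : Fin d => (volume : Measure ℝ).restrict (Set.Icc (0:ℝ) 1)]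
                fun u => ∑ v ∈ s, β v * ∏ i, truncPow (q-1) (u i - v i)}) ≤
          ENNReal.ofReal (Real.exp
            (C * ε ^ (-(1/(q:ℝ))) * Real.log (1/ε) ^ ((d:ℝ) - 1) *
              Real.log (1/ε) ^ (1/(2*(q:ℝ))))) := by
  obtain ⟨e, rfl⟩ : ∃ e, d = e + 1 := ⟨d - 1, by omega⟩
  have hq0 : (0:ℝ) < q := Nat.cast_pos.2 hq
  set K : ℝ := (4 * (e + 1) * q) ^ 2 with hK
  have hK0 : 0 < K := by positivity
  have hC₃ : 0 ≤ Real.log (3 * (K + 2) ^ (e + 1)) + 2 * ((e + 1 : ℕ) : ℝ) := by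
    have : 1 ≤ (K + 2) ^ (e + 1) := one_le_pow₀ (by linarith)
    exact add_nonneg (Real.log_nonneg (by linarith)) (by positivity)
  obtain ⟨C, hC, hmain⟩ := exists_entropy_bound_of_hasWidthBound
    (G := Lp ℝ 2 (Measure.pi fun _ : Fin (e + 1) => unitVol)) hq e
    (C₁ := (3 * q) ^ (e + 1)) (C₂ := (2 ^ (2 * q - 1)) ^ (e + 1) * (2 * (e + 1) ^ e))
    (by positivity) hC₃ (by positivity)
  refine ⟨C, hC, Real.exp (-1), ⟨Real.exp_pos _, ?_⟩, fun ε hε => ?_⟩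
  · rw [Real.exp_neg, one_div]
    exact inv_anti₀ two_pos (by linarith [Real.add_one_le_exp (1:ℝ)])
  have hε0 : 0 < ε := hε.1
  set M := ⌈K / ε ^ 2⌉₊ with hM
  have hM0 : 0 < M := Nat.ceil_pos.2 (by positivity)
  have hM0' : (0:ℝ) < M := Nat.cast_pos.2 hM0
  have hgrid : ∀ (j : Fin (e + 1) → Fin (M + 1)) (i : Fin (e + 1)),
      ((j i : ℕ) : ℝ) / M ∈ Set.Icc (0:ℝ) 1 := fun j i =>
    ⟨by positivity, (div_le_one hM0').2 (Nat.cast_le.2 (Nat.lt_succ_iff.1 (j i).2))⟩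
  obtain ⟨t, htcard, ht⟩ := hmain ε hε (Fin (e + 1) → Fin (M + 1))
    (fun j => tensorTruncPow (q - 1) fun i => ((j i : ℕ) : ℝ) / M)
    (fun j => norm_tensorTruncPow_le_one _ fun i => (hgrid j i).1)
    (hasWidthBound_tensorTruncPow hq e hgrid)
    (by simpa using log_card_grid_le hK0.le hε (e + 1))
  have hδ : (((e + 1 : ℕ) : ℝ)) * ((((q - 1 : ℕ) : ℝ) + 1) * √(1 / M)) ≤ ε / 4 := by
    have h1 : 1 / (M : ℝ) ≤ (ε / (4 * (e + 1) * q)) ^ 2 := by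
      rw [div_pow, ← hK, one_div_le hM0' (by positivity), one_div_div]
      exact Nat.le_ceil _
    have h2 : √(1 / (M : ℝ)) ≤ ε / (4 * (e + 1) * q) := Real.sqrt_le_iff.2 ⟨by positivity, h1⟩
    rw [Nat.cast_sub hq, Nat.cast_one, sub_add_cancel]
    push_cast
    calc _ ≤ ((e : ℝ) + 1) * (q * (ε / (4 * (e + 1) * q))) := by gcongr
      _ = ε / 4 := by field_simp
  choose! r hr using fun (x : ℝ) (hx : x ∈ Set.Icc (0:ℝ) 1) => exists_grid_near hM0 hx
  refine (covN_closure_le (t := t) ?_).trans ?_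
  · rintro g ⟨s, β, hs, hβ, hg⟩
    obtain ⟨x, hx, hgx⟩ := exists_mem_absConvSpan_near hβ (ψ := tensorTruncPow (q - 1))
      (φ := fun j : Fin (e + 1) → Fin (M + 1) =>
        tensorTruncPow (q - 1) fun i => ((j i : ℕ) : ℝ) / M)
      (r := fun v i => r (v i)) (δ := ε / 4) (by positivity)
      (fun v hv => (norm_tensorTruncPow_sub_le _ (hs v hv) (hgrid _)
        fun i => hr _ (hs v hv i)).trans hδ)
    rw [← eq_sum_smul_tensorTruncPow hg] at hgx
    obtain ⟨c, hc, hxc⟩ := ht x hx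
    refine ⟨c, hc, ?_⟩
    rw [dist_eq_norm]
    linarith [norm_sub_le_norm_sub_add_norm_sub g x c]
  · rw [← ENNReal.ofReal_natCast]
    refine ENNReal.ofReal_le_ofReal (htcard.trans_eq ?_)
    rw [Nat.cast_add, Nat.cast_one, add_sub_cancel_right, Real.rpow_natCast]
end
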